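/- Let f be a pseudo-polynomial. Then there exist η > 0, C > 0 and N₀ ∈ ℕ, depending only on f, such that for every real number ξ and every integer N ≥ N₀ one has min_{p ≤ N, p prime} ‖ξ⌊f(p)⌋‖ ≤ C·N^{−η}. -/

import Mathlib

/-- Distance from a real number to the nearest integer. -/
noncomputable def nearestIntDist (x : ℝ) : ℝ := |x - round x|

/-- A pseudo-polynomial: `f(x) = α₁ x^{θ₁} + ⋯ + α_d x^{θ_d}` with all `αᵢ > 0`,
`1 ≤ θ₁ < ⋯ < θ_d`, and at least one `θⱼ` not an integer. -/
def IsPseudoPoly (f : ℝ → ℝ) : Prop :=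
  ∃ (d : ℕ) (α θ : Fin (d + 1) → ℝ),
    (∀ i, 0 < α i) ∧ (1 ≤ θ 0) ∧ StrictMono θ ∧
    (∃ i, ∀ m : ℤ, θ i ≠ (m : ℝ)) ∧
    ∀ x : ℝ, f x = ∑ i, α i * x ^ (θ i)

/-- The additive character `x ↦ exp (2πix)`. -/
noncomputable def addChar (x : ℝ) : ℂ := Complex.exp ((2 * Real.pi * x : ℝ) * Complex.I)

theorem norm_addChar (x : ℝ) : ‖addChar x‖ = 1 := Complex.norm_exp_ofReal_mul_I _

theorem addChar_zero : addChar 0 = 1 := by simp [addChar]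

theorem addChar_add (x y : ℝ) : addChar (x + y) = addChar x * addChar y := by
  rw [addChar, addChar, addChar, ← Complex.exp_add]
  congr 1
  push_cast
  ring

theorem conj_addChar (x : ℝ) : (starRingEnd ℂ) (addChar x) = addChar (-x) := by
  rw [addChar, addChar, ← Complex.exp_conj, map_mul, Complex.conj_I, Complex.conj_ofReal]
  congr 1
  push_cast
  ring

theorem addChar_sub (x y : ℝ) : addChar (x - y) = addChar x * (starRingEnd ℂ) (addChar y) := by
  rw [conj_addChar, ← addChar_add, sub_eq_add_neg]

theorem addChar_nat_mul (x : ℝ) (n : ℕ) : addChar (n * x) = addChar x ^ n := by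
  rw [addChar, addChar, ← Complex.exp_nat_mul]
  congr 1
  push_cast
  ring

theorem addChar_intCast (n : ℤ) : addChar n = 1 := by
  rw [addChar, Complex.exp_eq_one_iff]
  exact ⟨n, by push_cast; ring⟩

theorem norm_addChar_sub_one (x : ℝ) : ‖addChar x - 1‖ = 2 * |Real.sin (Real.pi * x)| := by
  have := Complex.norm_exp_I_mul_ofReal_sub_one (2 * Real.pi * x)
  rw [addChar, mul_comm, this, Real.norm_eq_abs, abs_mul, abs_of_pos (two_pos : (0 : ℝ) < 2)]
  congr 3
  ring

theorem norm_addChar_sub_addChar_le (x y : ℝ) :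
    ‖addChar x - addChar y‖ ≤ 2 * Real.pi * |x - y| := by
  have h : addChar x - addChar y = addChar y * (addChar (x - y) - 1) := by
    rw [mul_sub, ← addChar_add]
    simp
  rw [h, norm_mul, norm_addChar, one_mul, norm_addChar_sub_one]
  have := Real.abs_sin_le_abs (x := Real.pi * (x - y))
  rw [abs_mul, abs_of_pos Real.pi_pos] at this
  linarith

theorem four_mul_abs_le_norm_addChar_sub_one {x : ℝ} (hx : |x| ≤ 1 / 2) :
    4 * |x| ≤ ‖addChar x - 1‖ := by
  rw [norm_addChar_sub_one]
  have h := Real.mul_abs_le_abs_sin (x := Real.pi * x) (by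
    rw [abs_mul, abs_of_pos Real.pi_pos]
    nlinarith [Real.pi_pos])
  rw [abs_mul, abs_of_pos Real.pi_pos] at h
  have : 2 / Real.pi * (Real.pi * |x|) = 2 * |x| := by
    field_simp
  linarith

theorem norm_geom_sum_addChar_le {x : ℝ} (hx : |x| ≤ 1 / 2) (h0 : x ≠ 0) (n : ℕ) :
    ‖∑ k ∈ Finset.range n, addChar (k * x)‖ ≤ 1 / (2 * |x|) := by
  have h4 := four_mul_abs_le_norm_addChar_sub_one hx
  have hpos : 0 < |x| := abs_pos.2 h0
  have hne : addChar x ≠ 1 := by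
    intro h
    rw [h, sub_self, norm_zero] at h4
    linarith
  simp_rw [addChar_nat_mul]
  rw [geom_sum_eq hne, norm_div, div_le_div_iff₀ (by linarith) (by positivity), one_mul]
  have : ‖addChar x ^ n - 1‖ ≤ 2 := by
    refine (norm_sub_le _ _).trans ?_
    rw [norm_pow, norm_addChar, one_pow, norm_one]
    norm_num
  nlinarith

/-- The van der Corput identity expanding `‖∑ u x‖²` by the difference of the two indices. -/
theorem normSq_sum_range_eq (u : ℕ → ℂ) (n : ℕ) :
    ‖∑ x ∈ Finset.range n, u x‖ ^ 2 = ∑ x ∈ Finset.range n, ‖u x‖ ^ 2 +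
      2 * (∑ h ∈ Finset.range n, ∑ x ∈ Finset.range (n - (h + 1)),
        u (x + (h + 1)) * (starRingEnd ℂ) (u x)).re := by
  induction n with
  | zero => simp
  | succ n ih =>
    have key : ∑ h ∈ Finset.range (n + 1), ∑ x ∈ Finset.range (n + 1 - (h + 1)),
        u (x + (h + 1)) * (starRingEnd ℂ) (u x) =
        (∑ h ∈ Finset.range n, ∑ x ∈ Finset.range (n - (h + 1)),
          u (x + (h + 1)) * (starRingEnd ℂ) (u x)) +
        u n * (starRingEnd ℂ) (∑ x ∈ Finset.range n, u x) := by
      rw [Finset.sum_range_succ]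
      simp only [Nat.sub_self, Finset.range_zero, Finset.sum_empty, add_zero]
      rw [map_sum, Finset.mul_sum,
        ← Finset.sum_range_reflect (fun x => u n * (starRingEnd ℂ) (u x)),
        ← Finset.sum_add_distrib]
      refine Finset.sum_congr rfl fun h hh => ?_
      rw [Finset.mem_range] at hh
      have e2 : n + 1 - (h + 1) = n - (h + 1) + 1 := by omega
      rw [e2, Finset.sum_range_succ, Nat.sub_add_cancel (by omega : h + 1 ≤ n),
        (by omega : n - 1 - h = n - (h + 1))]
    rw [Finset.sum_range_succ, key, Finset.sum_range_succ, Complex.add_re, mul_add]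
    rw [← Complex.normSq_eq_norm_sq] at *
    rw [Complex.normSq_add, ih, ← Complex.normSq_eq_norm_sq]
    have : (u n * (starRingEnd ℂ) (∑ x ∈ Finset.range n, u x)).re =
        ((∑ x ∈ Finset.range n, u x) * (starRingEnd ℂ) (u n)).re := by
      simp only [Complex.mul_re, Complex.conj_re, Complex.conj_im]
      ring
    rw [this]
    ring

theorem normSq_sum_addChar_le (g : ℕ → ℝ) (n : ℕ) :
    ‖∑ x ∈ Finset.range n, addChar (g x)‖ ^ 2 ≤ n + 2 * ∑ h ∈ Finset.range n,
      ‖∑ x ∈ Finset.range (n - (h + 1)), addChar (g (x + (h + 1)) - g x)‖ := by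
  rw [normSq_sum_range_eq]
  simp only [norm_addChar, addChar_sub]
  gcongr
  · simp
  · exact (Complex.re_le_norm _).trans (norm_sum_le _ _)

theorem sum_rpow_neg_half_le (n : ℕ) :
    ∑ h ∈ Finset.range n, ((h + 1 : ℕ) : ℝ) ^ (-(1 / 2) : ℝ) ≤ 2 * (n : ℝ) ^ (1 / 2 : ℝ) := by
  induction n with
  | zero => simp
  | succ n ih =>
    rw [Finset.sum_range_succ]
    rw [← Real.sqrt_eq_rpow] at *
    rw [Real.rpow_neg (by positivity), ← Real.sqrt_eq_rpow]
    have h1 : 0 < Real.sqrt ((n + 1 : ℕ) : ℝ) := Real.sqrt_pos.2 (by positivity)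
    have h2 : 0 ≤ Real.sqrt (n : ℝ) := Real.sqrt_nonneg _
    have h3 := Real.sq_sqrt (show (0 : ℝ) ≤ ((n + 1 : ℕ) : ℝ) by positivity)
    have h4 := Real.sq_sqrt (show (0 : ℝ) ≤ (n : ℝ) by positivity)
    have h5 : (Real.sqrt ((n + 1 : ℕ) : ℝ))⁻¹ ≤
        2 * (Real.sqrt ((n + 1 : ℕ) : ℝ) - Real.sqrt n) := by
      rw [inv_le_iff_one_le_mul₀ h1]
      push_cast at *
      nlinarith [sq_nonneg (Real.sqrt ((n : ℝ) + 1) - Real.sqrt n)]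
    linarith

theorem sum_rpow_neg_le {ρ : ℝ} (h2 : ρ ≤ 1 / 2) (n L : ℕ) (hn : n ≤ L) :
    ∑ h ∈ Finset.range n, ((h + 1 : ℕ) : ℝ) ^ (-ρ) ≤ 2 * (L : ℝ) * (L : ℝ) ^ (-ρ) := by
  rcases Nat.eq_zero_or_pos L with rfl | hL
  · simp [Nat.le_zero.1 hn]
  have hL' : (0 : ℝ) < L := by exact_mod_cast hL
  calc ∑ h ∈ Finset.range n, ((h + 1 : ℕ) : ℝ) ^ (-ρ)
      ≤ ∑ h ∈ Finset.range L, ((h + 1 : ℕ) : ℝ) ^ (-ρ) := by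
        refine Finset.sum_le_sum_of_subset_of_nonneg (Finset.range_mono hn) ?_
        intros; positivity
    _ ≤ ∑ h ∈ Finset.range L, (L : ℝ) ^ (1 / 2 - ρ) * ((h + 1 : ℕ) : ℝ) ^ (-(1 / 2) : ℝ) := by
        refine Finset.sum_le_sum fun h hh => ?_
        have : ((h + 1 : ℕ) : ℝ) ^ (-ρ) =
            ((h + 1 : ℕ) : ℝ) ^ (1 / 2 - ρ) * ((h + 1 : ℕ) : ℝ) ^ (-(1 / 2) : ℝ) := by
          rw [← Real.rpow_add (by positivity)]
          congr 1
          ring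
        rw [this]
        have hhL : h + 1 ≤ L := by simpa [Nat.succ_le_iff] using hh
        have : ((h + 1 : ℕ) : ℝ) ^ (1 / 2 - ρ) ≤ (L : ℝ) ^ (1 / 2 - ρ) :=
          Real.rpow_le_rpow (by positivity) (by exact_mod_cast hhL) (by linarith)
        gcongr
    _ ≤ (L : ℝ) ^ (1 / 2 - ρ) * (2 * (L : ℝ) ^ (1 / 2 : ℝ)) := by
        rw [← Finset.mul_sum]
        exact mul_le_mul_of_nonneg_left (sum_rpow_neg_half_le L) (by positivity)
    _ = 2 * (L : ℝ) * (L : ℝ) ^ (-ρ) := by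
        have e : (L : ℝ) = (L : ℝ) ^ (1 : ℝ) := (Real.rpow_one _).symm
        calc (L : ℝ) ^ (1 / 2 - ρ) * (2 * (L : ℝ) ^ (1 / 2 : ℝ))
            = 2 * (L : ℝ) ^ ((1 / 2 - ρ) + 1 / 2) := by rw [Real.rpow_add hL']; ring
          _ = 2 * (L : ℝ) ^ (1 + -ρ) := by congr 2; ring
          _ = _ := by rw [Real.rpow_add hL', Real.rpow_one]; ring

open Polynomial in
theorem natDegree_taylor_sub_le {P : ℝ[X]} {K : ℕ} (hP : P.natDegree ≤ K + 1) (h : ℝ) :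
    (P.taylor h - P).natDegree ≤ K ∧
      (P.taylor h - P).coeff K = (K + 1 : ℕ) * h * P.coeff (K + 1) := by
  have hs : ∀ k ≤ K + 1, (P.taylor h).coeff k =
      ∑ i ∈ Finset.range (K + 2), ((i.choose k : ℕ) : ℝ) * P.coeff i * h ^ (i - k) := by
    intro k _
    rw [taylor_coeff, hasseDeriv_apply, Polynomial.sum_over_range' _ _ (K + 2) (by omega),
      eval_finsetSum]
    · simp
    · simp
  constructor
  · rw [natDegree_le_iff_coeff_eq_zero]
    intro n hn
    rcases Nat.lt_or_ge (K + 1) n with h1 | h1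
    · rw [coeff_sub, coeff_eq_zero_of_natDegree_lt (lt_of_le_of_lt hP h1),
        coeff_eq_zero_of_natDegree_lt (by rw [natDegree_taylor]; omega), sub_zero]
    · obtain rfl : n = K + 1 := by omega
      rw [coeff_sub, hs _ le_rfl, Finset.sum_range_succ, Finset.sum_eq_zero]
      · simp
      · intro i hi
        rw [Nat.choose_eq_zero_of_lt (by simpa using hi)]
        simp
  · rw [coeff_sub, hs _ (by omega), Finset.sum_range_succ, Finset.sum_range_succ,
      Finset.sum_eq_zero]
    · simp
      ring
    · intro i hi
      rw [Nat.choose_eq_zero_of_lt (by simpa using hi)]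
      simp

open Polynomial in
/-- Weyl's bound for a polynomial whose leading coefficient is so small that differencing never
wraps around modulo one. -/
theorem exists_norm_sum_addChar_polynomial_le (K : ℕ) : ∃ C : ℝ, 1 ≤ C ∧
    ∀ (P : ℝ[X]) (L n : ℕ), P.natDegree ≤ K + 1 → n ≤ L → P.coeff (K + 1) ≠ 0 →
      ((K + 1).factorial : ℝ) * |P.coeff (K + 1)| * (L : ℝ) ^ K ≤ 1 / 2 →
      ‖∑ x ∈ Finset.range n, addChar (P.eval (x : ℝ))‖ ≤
        C * L * (|P.coeff (K + 1)| * (L : ℝ) ^ (K + 1)) ^ (-(1 / 2 ^ (K + 1)) : ℝ) := by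
  induction K with
  | zero =>
    refine ⟨1, le_rfl, fun P L n hP hn h0 hc => ?_⟩
    rcases Nat.eq_zero_or_pos L with rfl | hL
    · simp [Nat.le_zero.1 hn]
    have hL' : (0 : ℝ) < L := by exact_mod_cast hL
    simp only [zero_add, Nat.factorial_one, Nat.cast_one, one_mul, pow_zero, mul_one, pow_one] at *
    have hPe : ∀ x : ℕ, addChar (P.eval (x : ℝ)) =
        addChar (P.coeff 0) * addChar (x * P.coeff 1) := by
      intro x
      rw [← addChar_add]
      conv_lhs => rw [eq_X_add_C_of_natDegree_le_one hP]
      simp only [eval_add, eval_mul, eval_C, eval_X]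
      congr 1
      ring
    simp_rw [hPe]
    rw [← Finset.mul_sum, norm_mul, norm_addChar, one_mul]
    have hpos : 0 < |P.coeff 1| * L := by positivity
    rcases le_total (|P.coeff 1| * L) 1 with h1 | h1
    · have : (1 : ℝ) ≤ (|P.coeff 1| * L) ^ (-(1 / 2) : ℝ) :=
        Real.one_le_rpow_of_pos_of_le_one_of_nonpos hpos h1 (by norm_num)
      calc _ ≤ ∑ x ∈ Finset.range n, ‖addChar (x * P.coeff 1)‖ := norm_sum_le _ _
        _ = n := by simp [norm_addChar]
        _ ≤ L := by exact_mod_cast hn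
        _ ≤ _ := le_mul_of_one_le_right hL'.le this
    · refine (norm_geom_sum_addChar_le hc h0 n).trans ?_
      have h3 : (|P.coeff 1| * L) ^ (-1 : ℝ) ≤ (|P.coeff 1| * L) ^ (-(1 / 2) : ℝ) :=
        Real.rpow_le_rpow_of_exponent_le h1 (by norm_num)
      rw [Real.rpow_neg_one] at h3
      have hp := abs_pos.2 h0
      calc 1 / (2 * |P.coeff 1|) ≤ L * (|P.coeff 1| * L)⁻¹ := by
            rw [mul_inv, mul_comm (|P.coeff 1|)⁻¹, ← mul_assoc, mul_inv_cancel₀ hL'.ne', one_mul,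
              one_div]
            exact inv_anti₀ hp (by linarith)
        _ ≤ _ := mul_le_mul_of_nonneg_left h3 hL'.le
  | succ K ih =>
    obtain ⟨C, hC, ih⟩ := ih
    refine ⟨1 + 4 * C, by linarith, fun P L n hP hn h0 hc => ?_⟩
    rcases Nat.eq_zero_or_pos L with rfl | hL
    · simp [Nat.le_zero.1 hn]
    have hL' : (0 : ℝ) < L := by exact_mod_cast hL
    have hL1 : (1 : ℝ) ≤ L := by exact_mod_cast hL
    set c := P.coeff (K + 1 + 1) with hcdef
    have hcp : 0 < |c| := abs_pos.2 h0
    set ρ : ℝ := 1 / 2 ^ (K + 1) with hρ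
    have hρ0 : 0 < ρ := by positivity
    have hρ2 : ρ ≤ 1 / 2 := by
      rw [hρ]
      refine one_div_le_one_div_of_le two_pos ?_
      rw [pow_succ]
      nlinarith [one_le_pow₀ (one_le_two : (1 : ℝ) ≤ 2) (n := K)]
    have hρ' : (1 / 2 ^ (K + 1 + 1) : ℝ) = ρ / 2 := by rw [hρ, pow_succ]; field_simp
    rw [hρ']
    set Y : ℝ := |c| * (L : ℝ) ^ (K + 1 + 1) with hY
    have hYp : 0 < Y := by positivity
    have hbound : ∀ h ∈ Finset.range n,
        ‖∑ x ∈ Finset.range (n - (h + 1)),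
          addChar (P.eval ((x + (h + 1) : ℕ) : ℝ) - P.eval (x : ℝ))‖ ≤
        C * L * (|c| * (L : ℝ) ^ (K + 1)) ^ (-ρ) * ((h + 1 : ℕ) : ℝ) ^ (-ρ) := by
      intro h hh
      rw [Finset.mem_range] at hh
      have hhL : ((h + 1 : ℕ) : ℝ) ≤ L := by exact_mod_cast (by omega : h + 1 ≤ L)
      obtain ⟨hd, hk⟩ := natDegree_taylor_sub_le hP ((h + 1 : ℕ) : ℝ)
      have hpos1 : (0 : ℝ) < ((K + 1 + 1 : ℕ) : ℝ) := by positivity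
      have hpos2 : (0 : ℝ) < ((h + 1 : ℕ) : ℝ) := by positivity
      have habs : |(P.taylor ((h + 1 : ℕ) : ℝ) - P).coeff (K + 1)| =
          ((K + 1 + 1 : ℕ) : ℝ) * ((h + 1 : ℕ) : ℝ) * |c| := by
        rw [hk, abs_mul, abs_mul, Nat.abs_cast, Nat.abs_cast]
      have := ih (P.taylor ((h + 1 : ℕ) : ℝ) - P) L (n - (h + 1)) hd (by omega)
        (by rw [hk]; positivity) (by
          rw [habs]
          refine le_trans ?_ hc
          rw [Nat.factorial_succ (K + 1), pow_succ]
          push_cast at *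
          calc ((K + 1).factorial : ℝ) * (((K : ℝ) + 1 + 1) * ((h : ℝ) + 1) * |c|) * (L : ℝ) ^ K
              = (((K : ℝ) + 1 + 1) * ((K + 1).factorial : ℝ) * |c| * (L : ℝ) ^ K) *
                ((h : ℝ) + 1) := by ring
            _ ≤ (((K : ℝ) + 1 + 1) * ((K + 1).factorial : ℝ) * |c| * (L : ℝ) ^ K) * L := by
              gcongr
            _ = _ := by ring)
      rw [habs] at this
      have heq : ∀ x : ℕ, (P.taylor ((h + 1 : ℕ) : ℝ) - P).eval (x : ℝ) =
          P.eval ((x + (h + 1) : ℕ) : ℝ) - P.eval (x : ℝ) := by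
        intro x
        rw [eval_sub, taylor_eval]
        push_cast
        rfl
      simp_rw [heq] at this
      refine this.trans ?_
      rw [mul_assoc (C * (L : ℝ)), ← Real.mul_rpow (by positivity) (by positivity)]
      refine mul_le_mul_of_nonneg_left ?_ (by positivity)
      refine Real.rpow_le_rpow_of_nonpos (by positivity) ?_ (by linarith)
      have h1 : (1 : ℝ) ≤ ((K + 1 + 1 : ℕ) : ℝ) := by exact_mod_cast (by omega : 1 ≤ K + 1 + 1)
      calc |c| * (L : ℝ) ^ (K + 1) * ((h + 1 : ℕ) : ℝ)
          = 1 * (((h + 1 : ℕ) : ℝ) * |c| * (L : ℝ) ^ (K + 1)) := by ring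
        _ ≤ ((K + 1 + 1 : ℕ) : ℝ) * (((h + 1 : ℕ) : ℝ) * |c| * (L : ℝ) ^ (K + 1)) := by gcongr
        _ = _ := by ring
    have hYL : Y ≤ L := by
      have hf : (1 : ℝ) ≤ ((K + 1 + 1).factorial : ℝ) := by
        exact_mod_cast Nat.factorial_pos _
      have : |c| * (L : ℝ) ^ (K + 1) ≤ 1 / 2 := by
        refine le_trans ?_ hc
        rw [mul_assoc]
        exact le_mul_of_one_le_left (by positivity) hf
      rw [hY, pow_succ, ← mul_assoc]
      nlinarith
    have hLY : (L : ℝ) ≤ (L : ℝ) ^ 2 * Y ^ (-ρ) := by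
      have : Y ^ ρ ≤ L := by
        rcases le_total Y 1 with h1 | h1
        · exact (Real.rpow_le_one hYp.le h1 hρ0.le).trans hL1
        · calc Y ^ ρ ≤ Y ^ (1 : ℝ) := Real.rpow_le_rpow_of_exponent_le h1 (by linarith)
            _ = Y := Real.rpow_one _
            _ ≤ L := hYL
      rw [Real.rpow_neg hYp.le, ← div_eq_mul_inv, le_div_iff₀ (by positivity), sq]
      gcongr
    have hsq := normSq_sum_addChar_le (fun x : ℕ => P.eval (x : ℝ)) n
    have hsum : ∑ h ∈ Finset.range n, ‖∑ x ∈ Finset.range (n - (h + 1)),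
          addChar (P.eval ((x + (h + 1) : ℕ) : ℝ) - P.eval (x : ℝ))‖ ≤
        2 * C * (L : ℝ) ^ 2 * Y ^ (-ρ) := by
      calc _ ≤ _ := Finset.sum_le_sum hbound
        _ = C * L * (|c| * (L : ℝ) ^ (K + 1)) ^ (-ρ) *
            ∑ h ∈ Finset.range n, ((h + 1 : ℕ) : ℝ) ^ (-ρ) := by rw [Finset.mul_sum]
        _ ≤ C * L * (|c| * (L : ℝ) ^ (K + 1)) ^ (-ρ) * (2 * (L : ℝ) * (L : ℝ) ^ (-ρ)) :=
            mul_le_mul_of_nonneg_left (sum_rpow_neg_le hρ2 n L hn) (by positivity)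
        _ = 2 * C * (L : ℝ) ^ 2 * ((|c| * (L : ℝ) ^ (K + 1)) ^ (-ρ) * (L : ℝ) ^ (-ρ)) := by ring
        _ = _ := by
            rw [← Real.mul_rpow (by positivity) (by positivity), hY, mul_assoc |c|, ← pow_succ]
    have hnL : (n : ℝ) ≤ L := by exact_mod_cast hn
    have hfin : ‖∑ x ∈ Finset.range n, addChar (P.eval (x : ℝ))‖ ^ 2 ≤
        ((1 + 4 * C) * L * Y ^ (-(ρ / 2))) ^ 2 := by
      have e1 : (Y ^ (-(ρ / 2))) ^ 2 = Y ^ (-ρ) := by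
        rw [← Real.rpow_natCast, ← Real.rpow_mul hYp.le]
        congr 1
        push_cast
        ring
      rw [mul_pow, mul_pow, e1]
      have : (1 + 4 * C) * ((L : ℝ) ^ 2 * Y ^ (-ρ)) ≤ (1 + 4 * C) ^ 2 * ((L : ℝ) ^ 2 * Y ^ (-ρ)) := by
        refine mul_le_mul_of_nonneg_right ?_ (by positivity)
        nlinarith
      nlinarith
    exact (sq_le_sq₀ (norm_nonneg _) (by positivity)).1 hfin

open Polynomial in
theorem exists_polynomial_abs_rpow_sub_le (θ : ℝ) (k : ℕ) (hθ : θ ≤ k + 1) {m : ℝ} (hm : 0 < m) :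
    ∃ P : ℝ[X], P.natDegree ≤ k ∧
      P.coeff k = (descPochhammer ℝ k).eval θ / k.factorial * m ^ (θ - k) ∧
      ∀ x : ℝ, 0 ≤ x → |(m + x) ^ θ - P.eval x| ≤
        |(descPochhammer ℝ (k + 1)).eval θ| / (k + 1).factorial * m ^ (θ - (k + 1)) *
          x ^ (k + 1) := by
  refine ⟨∑ i ∈ Finset.range (k + 1),
    C ((descPochhammer ℝ i).eval θ / i.factorial * m ^ (θ - i)) * X ^ i, ?_, ?_, ?_⟩
  · refine natDegree_sum_le_of_forall_le _ _ fun i hi => ?_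
    exact (natDegree_C_mul_X_pow_le _ _).trans (by simpa [Nat.lt_succ_iff] using hi)
  · simp only [finsetSum_coeff, coeff_C_mul_X_pow]
    simp
  · intro x hx
    rcases hx.eq_or_lt with rfl | hx
    · rw [eval_finsetSum, Finset.sum_range_succ']
      simp
    have hne : m ≠ m + x := by linarith
    have hcont : ∀ n : ℕ, ContDiffOn ℝ n (fun y : ℝ => y ^ θ) (Set.uIcc m (m + x)) := by
      intro n
      refine contDiffOn_id.rpow_const_of_ne fun y hy => ?_
      rw [Set.uIcc_of_le (by linarith)] at hy
      exact (lt_of_lt_of_le hm hy.1).ne'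
    obtain ⟨y, hy, h⟩ := taylor_mean_remainder_lagrange_iteratedDeriv hne
      (n := k) (f := fun y : ℝ => y ^ θ) (by exact_mod_cast hcont (k + 1))
    have hT : taylorWithinEval (fun y : ℝ => y ^ θ) k (Set.uIcc m (m + x)) m (m + x) =
        eval x (∑ i ∈ Finset.range (k + 1),
          C ((descPochhammer ℝ i).eval θ / i.factorial * m ^ (θ - i)) * X ^ i) := by
      rw [taylor_within_apply, eval_finsetSum]
      refine Finset.sum_congr rfl fun i _ => ?_
      rw [iteratedDerivWithin_eq_iteratedDeriv (uniqueDiffOn_uIcc hne)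
        (Real.contDiffAt_rpow_const_of_ne hm.ne') Set.left_mem_uIcc, iteratedDeriv_eq_iterate,
        Real.iter_deriv_rpow_const]
      simp
      ring
    rw [hT] at h
    rw [h, iteratedDeriv_eq_iterate, Real.iter_deriv_rpow_const]
    rw [Set.uIoo_of_le (by linarith)] at hy
    have hy0 : 0 < y := hm.trans hy.1
    have hle : y ^ (θ - ((k + 1 : ℕ) : ℝ)) ≤ m ^ (θ - (k + 1)) := by
      push_cast
      exact Real.rpow_le_rpow_of_nonpos hm hy.1.le (by linarith)
    rw [add_sub_cancel_left, abs_div, abs_mul, abs_mul, abs_of_pos (Real.rpow_pos_of_pos hy0 _),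
      abs_of_pos (pow_pos hx _), Nat.abs_cast]
    calc _ ≤ |(descPochhammer ℝ (k + 1)).eval θ| * m ^ (θ - (k + 1)) * x ^ (k + 1) /
          (k + 1).factorial := by gcongr
      _ = _ := by ring

theorem descPochhammer_eval_ne_zero {θ : ℝ} (h : ∀ m : ℕ, θ ≠ m) (k : ℕ) :
    (descPochhammer ℝ k).eval θ ≠ 0 := by
  rw [descPochhammer_eval_eq_prod_range]
  exact Finset.prod_ne_zero_iff.2 fun i _ => sub_ne_zero.2 (h i)

/-- `i₀` is the index of the largest exponent that is not a natural number. -/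
structure IsTopIndex {ι : Type*} (θ : ι → ℝ) (i₀ : ι) : Prop where
  ne_natCast : ∀ m : ℕ, θ i₀ ≠ m
  one_le : ∀ i, 1 ≤ θ i
  lt_of_ne : ∀ i, i ≠ i₀ → (∃ m : ℕ, θ i = m) ∨ θ i < θ i₀

/-- The weights at non-integral exponents are dominated by the weight at `i₀`. -/
def IsDominated {ι : Type*} (θ : ι → ℝ) (i₀ : ι) (w : ι → ℝ) : Prop :=
  ∀ i, (∃ m : ℕ, θ i = m) ∨ |w i| ≤ |w i₀|

open Polynomial in
theorem exists_local_polynomial {ι : Type*} [Fintype ι] (α θ : ι → ℝ) (i₀ : ι)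
    (hα : 0 < α i₀) (hθ : IsTopIndex θ i₀) (k : ℕ) (hk : ∀ i, θ i < k) :
    ∃ c₁ c₂ M₀ : ℝ, 0 < c₁ ∧ 0 < c₂ ∧ 1 ≤ M₀ ∧ ∀ m : ℝ, M₀ ≤ m → ∀ w : ι → ℝ,
      IsDominated θ i₀ w →
      ∃ P : ℝ[X], P.natDegree ≤ k ∧
        c₁ * (|w i₀| * m ^ θ i₀) ≤ |P.coeff k| * m ^ k ∧
        |P.coeff k| * m ^ k ≤ c₂ * (|w i₀| * m ^ θ i₀) ∧
        ∀ x : ℝ, 0 ≤ x → |∑ i, α i * w i * (m + x) ^ θ i - P.eval x| ≤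
          c₂ * (|w i₀| * m ^ θ i₀) * (x / m) ^ (k + 1) := by
  classical
  set κ : ι → ℝ := fun i => α i * ((descPochhammer ℝ k).eval (θ i) / k.factorial) with hκ
  set κ' : ι → ℝ := fun i =>
    |α i| * (|(descPochhammer ℝ (k + 1)).eval (θ i)| / (k + 1).factorial) with hκ'
  have hκ0 : ∀ i, (∃ m : ℕ, θ i = m) → κ i = 0 := by
    rintro i ⟨m, hm⟩
    have : m < k := by exact_mod_cast hm ▸ hk i
    simp [hκ, hm, descPochhammer_eval_coe_nat_of_lt this]
  have hκ'0 : ∀ i, (∃ m : ℕ, θ i = m) → κ' i = 0 := by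
    rintro i ⟨m, hm⟩
    have : m < k := by exact_mod_cast hm ▸ hk i
    simp [hκ', hm, descPochhammer_eval_coe_nat_of_lt (this.trans (Nat.lt_succ_self k))]
  have hκ'nn : ∀ i, 0 ≤ κ' i := fun i => by positivity
  have hκi : κ i₀ ≠ 0 := by
    have := descPochhammer_eval_ne_zero hθ.ne_natCast k
    have hf : (k.factorial : ℝ) ≠ 0 := by positivity
    simp only [hκ]
    positivity
  have htend : Filter.Tendsto (fun m : ℝ => ∑ i ∈ Finset.univ.erase i₀, |κ i| * m ^ (θ i - θ i₀))
      Filter.atTop (nhds 0) := by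
    rw [← Finset.sum_const_zero (s := Finset.univ.erase i₀)]
    refine tendsto_finsetSum _ fun i hi => ?_
    rcases hθ.lt_of_ne i (Finset.ne_of_mem_erase hi) with h | h
    · simp [hκ0 i h]
    · rw [← mul_zero (|κ i|)]
      refine Filter.Tendsto.const_mul _ ?_
      have := tendsto_rpow_neg_atTop (y := θ i₀ - θ i) (by linarith)
      simpa using this
  obtain ⟨M₁, hM₁⟩ := Filter.eventually_atTop.1
    (htend.eventually_le_const (show (0 : ℝ) < |κ i₀| / 2 by positivity))
  have hmle : ∀ m : ℝ, 1 ≤ m → ∀ i, (∃ n : ℕ, θ i = n) ∨ m ^ θ i ≤ m ^ θ i₀ := by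
    intro m hm i
    by_cases hi : i = i₀
    · right; rw [hi]
    · rcases hθ.lt_of_ne i hi with h | h
      · exact Or.inl h
      · exact Or.inr (Real.rpow_le_rpow_of_exponent_le hm h.le)
  have hc2 : 0 < (∑ i, |κ i|) + ∑ i, κ' i := by
    have h1 : 0 < ∑ i, |κ i| :=
      Finset.sum_pos' (fun i _ => abs_nonneg _) ⟨i₀, Finset.mem_univ _, abs_pos.2 hκi⟩
    have h2 : 0 ≤ ∑ i, κ' i := Finset.sum_nonneg fun i _ => hκ'nn i
    linarith
  refine ⟨|κ i₀| / 2, (∑ i, |κ i|) + ∑ i, κ' i, max 1 M₁, by positivity, hc2, le_max_left _ _, ?_⟩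
  intro m hm w hw
  have hm1 : 1 ≤ m := (le_max_left _ _).trans hm
  have hm0 : 0 < m := by linarith
  have hmM : M₁ ≤ m := (le_max_right _ _).trans hm
  choose P hPd hPc hPe using fun i =>
    exists_polynomial_abs_rpow_sub_le (θ i) k (by linarith [hk i]) hm0
  have hcoeff : (∑ i, C (α i * w i) * P i).coeff k * m ^ k = ∑ i, κ i * w i * m ^ θ i := by
    rw [finsetSum_coeff, Finset.sum_mul]
    refine Finset.sum_congr rfl fun i _ => ?_
    rw [coeff_C_mul, hPc, Real.rpow_sub hm0, Real.rpow_natCast]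
    simp only [hκ]
    field_simp
  have habs : |(∑ i, C (α i * w i) * P i).coeff k| * m ^ k = |∑ i, κ i * w i * m ^ θ i| := by
    rw [← hcoeff, abs_mul, abs_of_pos (pow_pos hm0 k)]
  have hW : 0 ≤ |w i₀| * m ^ θ i₀ := by positivity
  have hterm : ∀ i, |κ i * w i * m ^ θ i| ≤ |κ i| * (|w i₀| * m ^ θ i₀) := by
    intro i
    rw [abs_mul, abs_mul, abs_of_pos (Real.rpow_pos_of_pos hm0 _), mul_assoc]
    by_cases hi : ∃ n : ℕ, θ i = n
    · simp [hκ0 i hi]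
    · have h1 := (hw i).resolve_left hi
      have h2 := (hmle m hm1 i).resolve_left hi
      gcongr
  refine ⟨∑ i, C (α i * w i) * P i, ?_, ?_, ?_, ?_⟩
  · exact natDegree_sum_le_of_forall_le _ _ fun i _ => (natDegree_C_mul_le _ _).trans (hPd i)
  · rw [habs, ← Finset.add_sum_erase _ _ (Finset.mem_univ i₀)]
    have h1 : |∑ i ∈ Finset.univ.erase i₀, κ i * w i * m ^ θ i| ≤
        |κ i₀| / 2 * (|w i₀| * m ^ θ i₀) := by
      calc _ ≤ ∑ i ∈ Finset.univ.erase i₀, |κ i * w i * m ^ θ i| := Finset.abs_sum_le_sum_abs _ _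
        _ ≤ ∑ i ∈ Finset.univ.erase i₀,
            |κ i| * m ^ (θ i - θ i₀) * (|w i₀| * m ^ θ i₀) := by
          refine Finset.sum_le_sum fun i _ => ?_
          rw [abs_mul, abs_mul, abs_of_pos (Real.rpow_pos_of_pos hm0 _)]
          by_cases hi : ∃ n : ℕ, θ i = n
          · simp [hκ0 i hi]
          · have h1 := (hw i).resolve_left hi
            have : |κ i| * m ^ (θ i - θ i₀) * (|w i₀| * m ^ θ i₀) = |κ i| * |w i₀| * m ^ θ i := by
              rw [Real.rpow_sub hm0]
              have := (Real.rpow_pos_of_pos hm0 (θ i₀)).ne'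
              field_simp
            rw [this]
            gcongr
        _ = (∑ i ∈ Finset.univ.erase i₀, |κ i| * m ^ (θ i - θ i₀)) * (|w i₀| * m ^ θ i₀) := by
          rw [Finset.sum_mul]
        _ ≤ _ := mul_le_mul_of_nonneg_right (hM₁ m hmM) hW
    have h2 : |κ i₀ * w i₀ * m ^ θ i₀| = |κ i₀| * (|w i₀| * m ^ θ i₀) := by
      rw [abs_mul, abs_mul, abs_of_pos (Real.rpow_pos_of_pos hm0 _), mul_assoc]
    have h3 := abs_sub_abs_le_abs_sub (κ i₀ * w i₀ * m ^ θ i₀)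
      (-∑ i ∈ Finset.univ.erase i₀, κ i * w i * m ^ θ i)
    rw [abs_neg, sub_neg_eq_add] at h3
    linarith
  · rw [habs]
    calc _ ≤ ∑ i, |κ i * w i * m ^ θ i| := Finset.abs_sum_le_sum_abs _ _
      _ ≤ ∑ i, |κ i| * (|w i₀| * m ^ θ i₀) := Finset.sum_le_sum fun i _ => hterm i
      _ = (∑ i, |κ i|) * (|w i₀| * m ^ θ i₀) := by rw [Finset.sum_mul]
      _ ≤ _ := mul_le_mul_of_nonneg_right
        (le_add_of_nonneg_right (Finset.sum_nonneg fun i _ => hκ'nn i)) hW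
  · intro x hx
    rw [eval_finsetSum, ← Finset.sum_sub_distrib]
    calc _ ≤ ∑ i, |α i * w i * (m + x) ^ θ i - eval x (C (α i * w i) * P i)| :=
          Finset.abs_sum_le_sum_abs _ _
      _ ≤ ∑ i, κ' i * (|w i₀| * m ^ θ i₀) * (x / m) ^ (k + 1) := by
        refine Finset.sum_le_sum fun i _ => ?_
        rw [eval_mul, eval_C, ← mul_sub, abs_mul, abs_mul]
        have h1 : |α i| * |w i| * |(m + x) ^ θ i - eval x (P i)| ≤
            κ' i * (|w i| * m ^ θ i) * (x / m) ^ (k + 1) := by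
          calc _ ≤ |α i| * |w i| * (|(descPochhammer ℝ (k + 1)).eval (θ i)| / (k + 1).factorial *
                m ^ (θ i - (k + 1)) * x ^ (k + 1)) := by gcongr; exact hPe i x hx
            _ = _ := by
              have : m ^ (θ i - ((k : ℝ) + 1)) = m ^ θ i / m ^ (k + 1) := by
                rw [Real.rpow_sub hm0]
                congr 1
                exact_mod_cast Real.rpow_natCast m (k + 1)
              rw [this, div_pow]
              simp only [hκ']
              ring
        refine h1.trans ?_
        by_cases hi : ∃ n : ℕ, θ i = n
        · simp [hκ'0 i hi]
        · have h1 := (hw i).resolve_left hi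
          have h2 := (hmle m hm1 i).resolve_left hi
          have := hκ'nn i
          gcongr
      _ = (∑ i, κ' i) * (|w i₀| * m ^ θ i₀) * (x / m) ^ (k + 1) := by
        rw [Finset.sum_mul, Finset.sum_mul]
      _ ≤ _ := by
        gcongr
        exact le_add_of_nonneg_left (Finset.sum_nonneg fun i _ => abs_nonneg _)

theorem norm_sum_range_le_of_blocks (G : ℕ → ℂ) {L : ℕ} (hL : 0 < L) {B : ℝ} (hB : 0 ≤ B)
    (n a : ℕ) (h : ∀ b l, a ≤ b → b + l ≤ a + n → l ≤ L →
      ‖∑ x ∈ Finset.range l, G (b + x)‖ ≤ B) :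
    ‖∑ x ∈ Finset.range n, G (a + x)‖ ≤ ((n : ℝ) / L + 1) * B := by
  induction n using Nat.strong_induction_on generalizing a with
  | _ n ih =>
    have hL' : (0 : ℝ) < L := by exact_mod_cast hL
    rcases le_or_gt n L with hn | hn
    · refine (h a n le_rfl le_rfl hn).trans (le_mul_of_one_le_left hB ?_)
      have : (0 : ℝ) ≤ (n : ℝ) / L := by positivity
      linarith
    · obtain ⟨q, rfl⟩ := Nat.exists_eq_add_of_le hn.le
      rw [Finset.sum_range_add]
      have h1 := h a L le_rfl (by omega) le_rfl
      have h2 := ih q (by omega) (a + L) (fun b l hb hl hlL => h b l (by omega) (by omega) hlL)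
      simp_rw [← Nat.add_assoc]
      refine (norm_add_le _ _).trans ((add_le_add h1 h2).trans (le_of_eq ?_))
      push_cast
      field_simp
      ring

set_option maxHeartbeats 1000000 in
theorem exists_block_bound {ι : Type*} [Fintype ι] (α θ : ι → ℝ) (i₀ : ι)
    (hα : 0 < α i₀) (hθ : IsTopIndex θ i₀) (A : ℝ) :
    ∃ C δ M₀ : ℝ, 0 < C ∧ 0 < δ ∧ δ < 1 ∧ 1 ≤ M₀ ∧ ∀ M : ℕ, M₀ ≤ M → ∀ w : ι → ℝ,
      IsDominated θ i₀ w → (M : ℝ) ^ (1 / 2 : ℝ) ≤ |w i₀| * (M : ℝ) ^ θ i₀ →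
      |w i₀| * (M : ℝ) ^ θ i₀ ≤ (M : ℝ) ^ A → ∀ a n : ℕ, M ≤ a → a + n ≤ 2 * M + 1 →
      ‖∑ x ∈ Finset.range n, addChar (∑ i, α i * w i * ((a + x : ℕ) : ℝ) ^ θ i)‖ ≤
        C * (M : ℝ) ^ (1 - δ) := by
  obtain ⟨K, hK⟩ : ∃ K : ℕ, (∀ i, θ i < ((K + 1 : ℕ) : ℝ)) ∧ 4 * A ≤ 2 * ((K + 1 : ℕ) : ℝ) + 1 := by
    obtain ⟨B, hB⟩ := (Set.finite_range θ).bddAbove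
    obtain ⟨K, hK⟩ := exists_nat_gt (max B (4 * A))
    refine ⟨K, fun i => ?_, ?_⟩
    · push_cast
      have := hB ⟨i, rfl⟩
      linarith [le_max_left B (4 * A)]
    · push_cast
      have := K.cast_nonneg (α := ℝ)
      linarith [le_max_right B (4 * A)]
  obtain ⟨hKθ, hKA⟩ := hK
  obtain ⟨c₁, c₂, M₁, hc₁, hc₂, hM₁, hloc⟩ := exists_local_polynomial α θ i₀ hα hθ (K + 1) hKθ
  obtain ⟨CW, hCW, hweyl⟩ := exists_norm_sum_addChar_polynomial_le K
  set k : ℕ := K + 1 with hk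
  have hk1 : (1 : ℝ) ≤ k := by rw [hk]; push_cast; linarith [K.cast_nonneg (α := ℝ)]
  set ρ : ℝ := 1 / 2 ^ k with hρ
  have hρ0 : 0 < ρ := by positivity
  have hρ1 : ρ ≤ 1 := by
    rw [hρ, div_le_one (by positivity)]
    exact one_le_pow₀ one_le_two
  set D : ℝ := 2 ^ θ i₀ with hD
  have hD0 : 0 < D := by positivity
  set s : ℝ := 2 / (2 * k + 1) with hs
  have hs0 : 0 < s := by positivity
  have hs1 : s < 1 := by
    rw [hs, div_lt_one (by positivity)]
    linarith
  have hsA : A * s ≤ 1 / 2 := by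
    rw [hs, mul_div_assoc', div_le_div_iff₀ (by positivity) two_pos]
    linarith
  have hsk : s * (k + 1 / 2) = 1 := by
    rw [hs]; field_simp
  set F : ℝ := 2 * Real.pi * c₂ * D + CW * (c₁ / 4 ^ k) ^ (-ρ) with hF
  have hF0 : 0 < F := by have := Real.pi_pos; positivity
  refine ⟨3 * F, s * ρ / 4, max M₁ ((4 * k.factorial * c₂ * D) ^ 4), by positivity,
    by positivity, by nlinarith, hM₁.trans (le_max_left _ _), ?_⟩
  intro M hM w hw hX1 hX2 a n ha han
  have hMM₁ : M₁ ≤ M := (le_max_left _ _).trans hM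
  set t : ℝ := (M : ℝ) with ht
  have ht1 : 1 ≤ t := hM₁.trans hMM₁
  have ht0 : 0 < t := by linarith
  set X : ℝ := |w i₀| * t ^ θ i₀ with hX
  have hX0 : 0 < X := lt_of_lt_of_le (Real.rpow_pos_of_pos ht0 _) hX1
  set r : ℝ := X ^ (-s) with hr
  have hr0 : 0 < r := Real.rpow_pos_of_pos hX0 _
  have hrlow : t ^ (-(1 / 2) : ℝ) ≤ r := by
    calc t ^ (-(1 / 2) : ℝ) ≤ t ^ (A * -s) :=
          Real.rpow_le_rpow_of_exponent_le ht1 (by linarith)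
      _ = (t ^ A) ^ (-s) := Real.rpow_mul ht0.le _ _
      _ ≤ r := Real.rpow_le_rpow_of_nonpos hX0 hX2 (by linarith)
  have hrup : r ≤ t ^ (-(s / 2)) := by
    calc r ≤ (t ^ (1 / 2 : ℝ)) ^ (-s) :=
          Real.rpow_le_rpow_of_nonpos (by positivity) hX1 (by linarith)
      _ = t ^ (-(s / 2)) := by
          rw [← Real.rpow_mul ht0.le]
          congr 1
          ring
  have hr1 : r ≤ 1 := hrup.trans (Real.rpow_le_one_of_one_le_of_nonpos ht1 (by linarith))
  have hXr : X * r ^ (k + 1 / 2 : ℝ) = 1 := by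
    rw [hr, ← Real.rpow_mul hX0.le, neg_mul, hsk, Real.rpow_neg_one, mul_inv_cancel₀ hX0.ne']
  have hXrk1 : X * r ^ (k + 1) = r ^ (1 / 2 : ℝ) := by
    have : r ^ (k + 1) = r ^ (k + 1 / 2 : ℝ) * r ^ (1 / 2 : ℝ) := by
      rw [← Real.rpow_add hr0, ← Real.rpow_natCast]
      congr 1
      push_cast
      ring
    rw [this, ← mul_assoc, hXr, one_mul]
  have hXrk : X * r ^ k = r ^ (-(1 / 2) : ℝ) := by
    have : r ^ k = r ^ (k + 1 / 2 : ℝ) * r ^ (-(1 / 2) : ℝ) := by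
      rw [← Real.rpow_add hr0, ← Real.rpow_natCast]
      congr 1
      ring
    rw [this, ← mul_assoc, hXr, one_mul]
  have hrt : t ^ (1 / 2 : ℝ) ≤ r * t := by
    calc t ^ (1 / 2 : ℝ) = t ^ (-(1 / 2) : ℝ) * t := by
          nth_rewrite 3 [← Real.rpow_one t]
          rw [← Real.rpow_add ht0]
          congr 1
          norm_num
      _ ≤ r * t := by gcongr
  have hrt1 : 1 ≤ r * t := (Real.one_le_rpow ht1 (by norm_num)).trans hrt
  set L : ℕ := ⌊r * t⌋₊ with hL
  have hLle : (L : ℝ) ≤ r * t := Nat.floor_le (by linarith)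
  have hLpos : 0 < L := Nat.floor_pos.2 hrt1
  have hLge : r * t / 2 ≤ L := by
    have h1 : r * t < L + 1 := Nat.lt_floor_add_one _
    have h2 : (1 : ℝ) ≤ L := by exact_mod_cast hLpos
    linarith
  have hL0 : (0 : ℝ) < L := by exact_mod_cast hLpos
  have hblock : ∀ b l, a ≤ b → b + l ≤ a + n → l ≤ L →
      ‖∑ x ∈ Finset.range l, addChar (∑ i, α i * w i * ((b + x : ℕ) : ℝ) ^ θ i)‖ ≤
        L * F * r ^ (ρ / 2) := by
    intro b l hb hbl hl
    rcases Nat.eq_zero_or_pos l with rfl | hl0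
    · simp only [Finset.range_zero, Finset.sum_empty, norm_zero]
      positivity
    have hbt : t ≤ b := Nat.cast_le.2 (ha.trans hb)
    have hbt2 : (b : ℝ) ≤ 2 * t := by
      rw [ht]
      exact_mod_cast (by omega : b ≤ 2 * M)
    have hb0 : (0 : ℝ) < b := by linarith
    obtain ⟨P, hPd, hPlow, hPup, hPe⟩ := hloc b (hMM₁.trans hbt) w hw
    set W : ℝ := |w i₀| * (b : ℝ) ^ θ i₀ with hW
    have hθ1 := hθ.one_le i₀
    have hWX : X ≤ W := by
      rw [hX, hW]
      gcongr
    have hWD : W ≤ D * X := by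
      calc W ≤ |w i₀| * (2 * t) ^ θ i₀ := by rw [hW]; gcongr
        _ = D * X := by rw [Real.mul_rpow two_pos.le ht0.le]; ring
    have hLb : (L : ℝ) / b ≤ r := by
      rw [div_le_iff₀ hb0]
      exact hLle.trans (by gcongr)
    have hLb' : r / 4 ≤ (L : ℝ) / b := by
      rw [le_div_iff₀ hb0]
      nlinarith
    have hsub : ‖∑ x ∈ Finset.range l, addChar (∑ i, α i * w i * ((b + x : ℕ) : ℝ) ^ θ i) -
        ∑ x ∈ Finset.range l, addChar (P.eval (x : ℝ))‖ ≤
        L * (2 * Real.pi * c₂ * D * r ^ (1 / 2 : ℝ)) := by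
      rw [← Finset.sum_sub_distrib]
      calc _ ≤ ∑ x ∈ Finset.range l, ‖addChar (∑ i, α i * w i * ((b + x : ℕ) : ℝ) ^ θ i) -
              addChar (P.eval (x : ℝ))‖ := norm_sum_le _ _
        _ ≤ ∑ x ∈ Finset.range l, (2 * Real.pi * c₂ * D * r ^ (1 / 2 : ℝ)) := by
            refine Finset.sum_le_sum fun x hx => ?_
            have hxL : (x : ℝ) ≤ L := by
              exact_mod_cast (Finset.mem_range.1 hx).le.trans hl
            refine (norm_addChar_sub_addChar_le _ _).trans ?_
            have h1 := hPe x x.cast_nonneg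
            have h2 : c₂ * W * ((x : ℝ) / b) ^ (k + 1) ≤ c₂ * (D * X) * r ^ (k + 1) := by
              have : (x : ℝ) / b ≤ r := le_trans (by gcongr) hLb
              gcongr
            have h3 : c₂ * (D * X) * r ^ (k + 1) = c₂ * D * r ^ (1 / 2 : ℝ) := by
              rw [← hXrk1]
              ring
            rw [h3] at h2
            push_cast
            have h4 := mul_le_mul_of_nonneg_left (h1.trans h2)
              (by have := Real.pi_pos; positivity : (0 : ℝ) ≤ 2 * Real.pi)
            refine h4.trans (le_of_eq ?_)
            ring
        _ = l * (2 * Real.pi * c₂ * D * r ^ (1 / 2 : ℝ)) := by simp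
        _ ≤ _ := by
            have : (l : ℝ) ≤ L := by exact_mod_cast hl
            have := Real.pi_pos
            gcongr
    have hW0 : 0 < W := hX0.trans_le hWX
    have hcb : 0 < |P.coeff k| * (b : ℝ) ^ k := lt_of_lt_of_le (by positivity) hPlow
    have hc0 : 0 < |P.coeff k| := pos_of_mul_pos_left hcb (by positivity)
    have hYeq : |P.coeff k| * (L : ℝ) ^ k = |P.coeff k| * (b : ℝ) ^ k * ((L : ℝ) / b) ^ k := by
      rw [div_pow]
      field_simp
    have hYup : |P.coeff k| * (L : ℝ) ^ k ≤ c₂ * D * r ^ (-(1 / 2) : ℝ) := by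
      rw [hYeq]
      calc _ ≤ c₂ * (D * X) * r ^ k := by
            have h1 : |P.coeff k| * (b : ℝ) ^ k ≤ c₂ * (D * X) := hPup.trans (by gcongr)
            exact mul_le_mul h1 (pow_le_pow_left₀ (by positivity) hLb k) (by positivity)
              (by positivity)
        _ = c₂ * D * (X * r ^ k) := by ring
        _ = _ := by rw [hXrk]
    have hYlow : c₁ / 4 ^ k * r ^ (-(1 / 2) : ℝ) ≤ |P.coeff k| * (L : ℝ) ^ k := by
      rw [hYeq]
      calc _ = c₁ * X * (r / 4) ^ k := by rw [← hXrk, div_pow]; ring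
        _ ≤ _ := by
            have h1 : c₁ * X ≤ |P.coeff k| * (b : ℝ) ^ k := le_trans (by gcongr) hPlow
            exact mul_le_mul h1 (pow_le_pow_left₀ (by positivity) hLb' k) (by positivity)
              (by positivity)
    have hsmall : (k.factorial : ℝ) * |P.coeff k| * (L : ℝ) ^ K ≤ 1 / 2 := by
      have h1 : (k.factorial : ℝ) * |P.coeff k| * (L : ℝ) ^ K * L ≤ 1 / 2 * L := by
        have hrq : r ^ (-(1 / 2) : ℝ) ≤ t ^ (1 / 4 : ℝ) := by
          calc r ^ (-(1 / 2) : ℝ) ≤ (t ^ (-(1 / 2) : ℝ)) ^ (-(1 / 2) : ℝ) :=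
                Real.rpow_le_rpow_of_nonpos (by positivity) hrlow (by norm_num)
            _ = t ^ (1 / 4 : ℝ) := by
                rw [← Real.rpow_mul ht0.le]
                norm_num
        have hbig : 4 * (k.factorial : ℝ) * c₂ * D ≤ t ^ (1 / 4 : ℝ) := by
          have h := (le_max_right _ _).trans hM
          calc _ = ((4 * (k.factorial : ℝ) * c₂ * D) ^ 4) ^ (1 / 4 : ℝ) := by
                rw [← Real.rpow_natCast, ← Real.rpow_mul (by positivity)]
                norm_num
            _ ≤ _ := Real.rpow_le_rpow (by positivity) h (by norm_num)
        have hqq : t ^ (1 / 4 : ℝ) * t ^ (1 / 4 : ℝ) = t ^ (1 / 2 : ℝ) := by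
          rw [← Real.rpow_add ht0]
          norm_num
        calc (k.factorial : ℝ) * |P.coeff k| * (L : ℝ) ^ K * L
            = (k.factorial : ℝ) * (|P.coeff k| * (L : ℝ) ^ k) := by rw [hk, pow_succ]; ring
          _ ≤ (k.factorial : ℝ) * (c₂ * D * t ^ (1 / 4 : ℝ)) := by
              have h1 : |P.coeff k| * (L : ℝ) ^ k ≤ c₂ * D * t ^ (1 / 4 : ℝ) :=
                hYup.trans (by gcongr)
              exact mul_le_mul_of_nonneg_left h1 (by positivity)
          _ = (4 * (k.factorial : ℝ) * c₂ * D) * t ^ (1 / 4 : ℝ) / 4 := by ring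
          _ ≤ t ^ (1 / 4 : ℝ) * t ^ (1 / 4 : ℝ) / 4 := by gcongr
          _ ≤ 1 / 2 * L := by
              rw [hqq]
              linarith
      exact le_of_mul_le_mul_right h1 hL0
    have hw1 := hweyl P L l hPd hl (abs_pos.1 hc0) hsmall
    have hw2 : (|P.coeff k| * (L : ℝ) ^ k) ^ (-ρ) ≤ (c₁ / 4 ^ k) ^ (-ρ) * r ^ (ρ / 2) := by
      calc _ ≤ (c₁ / 4 ^ k * r ^ (-(1 / 2) : ℝ)) ^ (-ρ) :=
            Real.rpow_le_rpow_of_nonpos (by positivity) hYlow (by linarith)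
        _ = (c₁ / 4 ^ k) ^ (-ρ) * r ^ (ρ / 2) := by
            rw [Real.mul_rpow (by positivity) (by positivity), ← Real.rpow_mul hr0.le]
            congr 2
            ring
    have hhalf : r ^ (1 / 2 : ℝ) ≤ r ^ (ρ / 2) :=
      Real.rpow_le_rpow_of_exponent_ge hr0 hr1 (by linarith)
    have htri := norm_le_norm_sub_add (∑ x ∈ Finset.range l,
      addChar (∑ i, α i * w i * ((b + x : ℕ) : ℝ) ^ θ i))
      (∑ x ∈ Finset.range l, addChar (P.eval (x : ℝ)))
    refine htri.trans ((add_le_add hsub hw1).trans ?_)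
    calc _ ≤ L * (2 * Real.pi * c₂ * D * r ^ (ρ / 2)) +
          CW * L * ((c₁ / 4 ^ k) ^ (-ρ) * r ^ (ρ / 2)) := by
            have := Real.pi_pos
            gcongr
      _ = _ := by rw [hF]; ring
  have hmain := norm_sum_range_le_of_blocks
    (fun y => addChar (∑ i, α i * w i * ((y : ℕ) : ℝ) ^ θ i)) hLpos
    (B := L * F * r ^ (ρ / 2)) (by positivity) n a hblock
  refine hmain.trans ?_
  have hn : (n : ℝ) ≤ 2 * t := by
    have h1 : (n : ℝ) ≤ M + 1 := by exact_mod_cast (by omega : n ≤ M + 1)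
    linarith
  have hLt : (L : ℝ) ≤ t := hLle.trans (by nlinarith)
  have hrρ : r ^ (ρ / 2) ≤ t ^ (-(s * ρ / 4)) := by
    calc r ^ (ρ / 2) ≤ (t ^ (-(s / 2))) ^ (ρ / 2) :=
          Real.rpow_le_rpow hr0.le hrup (by positivity)
      _ = _ := by
          rw [← Real.rpow_mul ht0.le]
          congr 1
          ring
  calc ((n : ℝ) / L + 1) * (L * F * r ^ (ρ / 2)) = (n + L) * (F * r ^ (ρ / 2)) := by
        field_simp
    _ ≤ (2 * t + t) * (F * t ^ (-(s * ρ / 4))) := by gcongr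
    _ = 3 * F * t ^ (1 - s * ρ / 4) := by
        rw [sub_eq_add_neg, Real.rpow_add ht0, Real.rpow_one]
        ring

section Vaughan

open Finset ArithmeticFunction
open scoped ArithmeticFunction.Moebius ArithmeticFunction.zeta

/-- Dyadic decomposition of a sum over an interval. -/
theorem norm_sum_Ioc_le_of_dyadic (G : ℕ → ℂ) {B : ℝ} (hB : 0 ≤ B) (Y : ℕ) (j a : ℕ)
    (h : ∀ M, a ≤ M → M < Y → ‖∑ k ∈ Ioc M (min (2 * M) Y), G k‖ ≤ B) (hY : Y ≤ 2 ^ j * a) :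
    ‖∑ k ∈ Ioc a Y, G k‖ ≤ j * B := by
  induction j generalizing a with
  | zero => simp [Finset.Ioc_eq_empty_of_le (show Y ≤ a by simpa using hY)]
  | succ j ih =>
    rcases le_or_gt Y a with hYa | hYa
    · rw [Finset.Ioc_eq_empty_of_le hYa, sum_empty, norm_zero]
      positivity
    · have h1 := h a le_rfl hYa
      have hle : min (2 * a) Y ≤ Y := min_le_right _ _
      have hge : a ≤ min (2 * a) Y := le_min (by lia) hYa.le
      rw [← sum_Ioc_consecutive G hge hle]
      have h2 : ‖∑ k ∈ Ioc (min (2 * a) Y) Y, G k‖ ≤ j * B := by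
        rcases le_total (2 * a) Y with hc | hc
        · rw [min_eq_left hc]
          refine ih (2 * a) (fun M hM => h M (by lia)) ?_
          rw [pow_succ] at hY
          lia
        · rw [min_eq_right hc]
          simp
          positivity
      push_cast
      linarith [norm_add_le (∑ k ∈ Ioc a (min (2 * a) Y), G k) (∑ k ∈ Ioc (min (2 * a) Y) Y, G k)]

/-- The restriction of an arithmetic function to the integers up to `u`. -/
def ArithmeticFunction.below (f : ArithmeticFunction ℝ) (u : ℕ) : ArithmeticFunction ℝ :=
  ⟨fun n => if n ≤ u then f n else 0, by simp⟩

theorem ArithmeticFunction.below_apply (f : ArithmeticFunction ℝ) (u n : ℕ) :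
    f.below u n = if n ≤ u then f n else 0 := rfl

theorem ArithmeticFunction.sub_below_apply (f : ArithmeticFunction ℝ) (u n : ℕ) :
    (f - f.below u) n = if n ≤ u then 0 else f n := by
  have h : (f - f.below u + f.below u) n = f n := by rw [sub_add_cancel]
  rw [add_apply, below_apply] at h
  split_ifs at h ⊢ <;> linarith

theorem vonMangoldt_eq_vaughan (u : ℕ) :
    vonMangoldt = vonMangoldt.below u + (μ : ArithmeticFunction ℝ).below u * log -
      ((μ : ArithmeticFunction ℝ).below u * vonMangoldt.below u) * (ζ : ArithmeticFunction ℝ) +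
      (vonMangoldt - vonMangoldt.below u) * (((μ : ArithmeticFunction ℝ) - (μ : ArithmeticFunction ℝ).below u) *
        (ζ : ArithmeticFunction ℝ)) := by
  have h1 := vonMangoldt_mul_zeta
  have h2 : (μ : ArithmeticFunction ℝ) * (ζ : ArithmeticFunction ℝ) = 1 :=
    coe_moebius_mul_coe_zeta
  rw [← h1]
  linear_combination (-(vonMangoldt - vonMangoldt.below u)) * h2

theorem sum_Ioc_mul_arithmeticFunction (f g : ArithmeticFunction ℝ) (F : ℕ → ℂ) (N : ℕ) :
    ∑ n ∈ Ioc 0 N, ((f * g) n : ℂ) * F n =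
      ∑ k ∈ Ioc 0 N, (f k : ℂ) * ∑ m ∈ Ioc 0 (N / k), (g m : ℂ) * F (k * m) := by
  have h1 : ∑ n ∈ Ioc 0 N, ((f * g) n : ℂ) * F n =
      ∑ x ∈ Ioc 0 N ×ˢ Ioc 0 N with x.1 * x.2 ≤ N, (f x.1 : ℂ) * ((g x.2 : ℂ) * F (x.1 * x.2)) := by
    simp only [mul_apply]
    trans ∑ n ∈ Ioc 0 N, ∑ x ∈ Ioc 0 N ×ˢ Ioc 0 N with x.1 * x.2 = n,
      (f x.1 : ℂ) * ((g x.2 : ℂ) * F (x.1 * x.2))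
    · refine sum_congr rfl fun n hn => ?_
      simp only [mem_Ioc] at hn
      rw [Nat.divisorsAntidiagonal_eq_prod_filter_of_le hn.1.ne' hn.2]
      push_cast
      rw [sum_mul]
      refine sum_congr rfl fun x hx => ?_
      rw [(mem_filter.1 hx).2, mul_assoc]
    · simp_rw [sum_filter]
      rw [sum_comm]
      exact sum_congr rfl fun _ _ => by simp_all
  rw [h1, sum_filter, sum_product]
  refine sum_congr rfl fun n hn => ?_
  rw [mul_sum, ← sum_filter]
  refine sum_congr ?_ fun _ _ => rfl
  ext m
  simp only [mem_filter, mem_Ioc, and_assoc] at hn ⊢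
  rw [Nat.le_div_iff_mul_le hn.1, mul_comm m]
  refine and_congr_right fun hm => and_iff_right_of_imp fun h => ?_
  exact (Nat.le_mul_of_pos_left m hn.1).trans h

theorem abs_below_le (f : ArithmeticFunction ℝ) (u n : ℕ) : |f.below u n| ≤ |f n| := by
  rw [ArithmeticFunction.below_apply]
  split_ifs <;> simp

theorem abs_moebius_le_one' (n : ℕ) : |(μ : ArithmeticFunction ℝ) n| ≤ 1 := by
  rw [intCoe_apply]
  exact_mod_cast (abs_moebius_le_one (n := n))

theorem abs_moebius_below_mul_vonMangoldt_below_le (u n : ℕ) :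
    |((μ : ArithmeticFunction ℝ).below u * vonMangoldt.below u) n| ≤ Real.log n := by
  rw [mul_apply, ← vonMangoldt_sum (n := n)]
  refine (abs_sum_le_sum_abs _ _).trans ?_
  rw [← Nat.sum_divisorsAntidiagonal' (f := fun _ d => vonMangoldt d)]
  refine sum_le_sum fun x _ => ?_
  rw [abs_mul]
  have h1 := (abs_below_le (μ : ArithmeticFunction ℝ) u x.1).trans (abs_moebius_le_one' x.1)
  have h2 := abs_below_le vonMangoldt u x.2
  rw [abs_of_nonneg vonMangoldt_nonneg] at h2
  nlinarith [abs_nonneg (vonMangoldt.below u x.2)]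

theorem moebius_below_mul_vonMangoldt_below_eq_zero {u n : ℕ} (h : u * u < n) :
    ((μ : ArithmeticFunction ℝ).below u * vonMangoldt.below u) n = 0 := by
  rw [mul_apply]
  refine sum_eq_zero fun x hx => ?_
  rw [Nat.mem_divisorsAntidiagonal] at hx
  rw [ArithmeticFunction.below_apply, ArithmeticFunction.below_apply]
  by_cases h1 : x.1 ≤ u
  · by_cases h2 : x.2 ≤ u
    · exact absurd (hx.1 ▸ Nat.mul_le_mul h1 h2) (not_le.2 h)
    · simp [h2]
  · simp [h1]

theorem abs_tail_mul_zeta_le (u n : ℕ) :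
    |(((μ : ArithmeticFunction ℝ) - (μ : ArithmeticFunction ℝ).below u) *
        (ζ : ArithmeticFunction ℝ)) n| ≤ n.divisors.card := by
  rw [coe_mul_zeta_apply]
  refine (abs_sum_le_sum_abs _ _).trans ?_
  rw [card_eq_sum_ones, Nat.cast_sum]
  refine sum_le_sum fun d _ => ?_
  rw [ArithmeticFunction.sub_below_apply]
  split_ifs
  · simp
  · simpa using abs_moebius_le_one' d

theorem tail_mul_zeta_eq_zero {u n : ℕ} (h : n ≤ u) :
    (((μ : ArithmeticFunction ℝ) - (μ : ArithmeticFunction ℝ).below u) *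
        (ζ : ArithmeticFunction ℝ)) n = 0 := by
  rw [coe_mul_zeta_apply]
  refine sum_eq_zero fun d hd => ?_
  rw [ArithmeticFunction.sub_below_apply, if_pos ((Nat.divisor_le hd).trans h)]

theorem card_divisors_le_two_sqrt (n : ℕ) : (n.divisors.card : ℝ) ≤ 2 * Real.sqrt n := by
  have h1 : n.divisors ⊆ Ioc 0 n.sqrt ∪ (Ioc 0 n.sqrt).image (fun d => n / d) := by
    intro d hd
    have hd' := Nat.mem_divisors.1 hd
    have hd0 := Nat.pos_of_mem_divisors hd
    rw [mem_union, mem_image]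
    rcases le_or_gt d n.sqrt with h | h
    · exact Or.inl (mem_Ioc.2 ⟨hd0, h⟩)
    · refine Or.inr ⟨n / d, mem_Ioc.2 ⟨Nat.div_pos (Nat.divisor_le hd) hd0, ?_⟩,
        Nat.div_div_self hd'.1 hd'.2⟩
      rw [← Nat.lt_succ_iff, Nat.div_lt_iff_lt_mul hd0]
      exact (Nat.lt_succ_sqrt n).trans_le (Nat.mul_le_mul_left _ h)
  have h2 : n.divisors.card ≤ n.sqrt + n.sqrt := by
    refine (card_le_card h1).trans ((card_union_le _ _).trans ?_)
    gcongr
    · simp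
    · exact card_image_le.trans (by simp)
  have h3 : (n.sqrt : ℝ) ≤ Real.sqrt n := Real.nat_sqrt_le_real_sqrt
  have h4 : (n.divisors.card : ℝ) ≤ n.sqrt + n.sqrt := by exact_mod_cast h2
  linarith

theorem sum_card_divisors_le (x : ℕ) :
    ∑ m ∈ Ioc 0 x, (m.divisors.card : ℝ) ≤ x * (1 + Real.log x) := by
  have h := sum_Ioc_sigma0_eq_sum_div x
  simp only [sigma_zero_apply] at h
  rw [← Nat.cast_sum, h, Nat.cast_sum]
  calc ∑ n ∈ Ioc 0 x, ((x / n : ℕ) : ℝ) ≤ ∑ n ∈ Ioc 0 x, (x : ℝ) * (n : ℝ)⁻¹ := by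
        refine sum_le_sum fun n _ => ?_
        rw [← div_eq_mul_inv]
        exact Nat.cast_div_le
    _ = x * (harmonic x : ℝ) := by
        rw [← mul_sum, harmonic_eq_sum_Icc]
        push_cast
        rfl
    _ ≤ _ := by
        gcongr
        exact harmonic_le_one_add_log x

end Vaughan

section Bilinear

open Finset ArithmeticFunction
open scoped ArithmeticFunction.Moebius ArithmeticFunction.zeta ComplexConjugate

theorem norm_sum_monotone_mul_le (a : ℕ → ℝ) (ha : Monotone a) (ha0 : 0 ≤ a 0) (G : ℕ → ℂ) {B : ℝ}
    (j : ℕ) (h : ∀ i ≤ j, ‖∑ m ∈ Ioc 0 i, G m‖ ≤ B) :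
    ‖∑ m ∈ Ioc 0 j, (a m : ℂ) * G m‖ ≤ 2 * a j * B := by
  have hB : 0 ≤ B := by simpa using h 0 (Nat.zero_le _)
  have ha' : ∀ i, 0 ≤ a i := fun i => ha0.trans (ha (Nat.zero_le i))
  have key : ∀ i ≤ j, ‖∑ m ∈ Ioc 0 i, (a m : ℂ) * G m - a i * ∑ m ∈ Ioc 0 i, G m‖ ≤ a i * B := by
    intro i
    induction i with
    | zero => intro _; simpa using mul_nonneg ha0 hB
    | succ i ih =>
      intro hi
      have h1 := ih (by lia)
      have h2 := h i (by lia)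
      rw [sum_Ioc_succ_top (Nat.zero_le i), sum_Ioc_succ_top (Nat.zero_le i)]
      have h3 : ∑ m ∈ Ioc 0 i, (a m : ℂ) * G m + a (i + 1) * G (i + 1) -
          a (i + 1) * (∑ m ∈ Ioc 0 i, G m + G (i + 1)) =
          (∑ m ∈ Ioc 0 i, (a m : ℂ) * G m - a i * ∑ m ∈ Ioc 0 i, G m) -
            ((a (i + 1) - a i : ℝ) : ℂ) * ∑ m ∈ Ioc 0 i, G m := by
        push_cast
        ring
      rw [h3]
      refine (norm_sub_le _ _).trans ?_
      have h4 : 0 ≤ a (i + 1) - a i := sub_nonneg.2 (ha (Nat.le_succ i))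
      rw [norm_mul, Complex.norm_real, Real.norm_of_nonneg h4]
      nlinarith
  have h1 := key j le_rfl
  have h2 : ‖(a j : ℂ) * ∑ m ∈ Ioc 0 j, G m‖ ≤ a j * B := by
    rw [norm_mul, Complex.norm_real, Real.norm_of_nonneg (ha' j)]
    exact mul_le_mul_of_nonneg_left (h j le_rfl) (ha' j)
  have h3 := norm_add_le (∑ m ∈ Ioc 0 j, (a m : ℂ) * G m - a j * ∑ m ∈ Ioc 0 j, G m)
    (a j * ∑ m ∈ Ioc 0 j, G m)
  rw [sub_add_cancel] at h3
  linarith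

theorem sum_div_le_mul_log (N : ℕ) (x : ℝ) (hx : 0 ≤ x) :
    ∑ k ∈ Ioc 0 N, x / (k : ℝ) ≤ x * (1 + Real.log N) := by
  have h := harmonic_le_one_add_log N
  rw [harmonic_eq_sum_Icc] at h
  push_cast at h
  simp_rw [div_eq_mul_inv, ← mul_sum]
  exact mul_le_mul_of_nonneg_left h hx

theorem normSq_sum_mul_le {ι : Type*} (s : Finset ι) (a : ι → ℝ) (z : ι → ℂ) :
    ‖∑ i ∈ s, (a i : ℂ) * z i‖ ^ 2 ≤ (∑ i ∈ s, a i ^ 2) * ∑ i ∈ s, ‖z i‖ ^ 2 := by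
  have h1 : ‖∑ i ∈ s, (a i : ℂ) * z i‖ ≤ ∑ i ∈ s, |a i| * ‖z i‖ := by
    refine (norm_sum_le _ _).trans (le_of_eq (sum_congr rfl fun i _ => ?_))
    rw [norm_mul, Complex.norm_real, Real.norm_eq_abs]
  have h2 := sum_mul_sq_le_sq_mul_sq s (fun i => |a i|) fun i => ‖z i‖
  simp only [sq_abs] at h2
  exact (pow_le_pow_left₀ (norm_nonneg _) h1 2).trans h2

/-- Expanding the mean square of a bilinear form. -/
theorem sum_normSq_le (s : Finset ℕ) (X : ℕ) (b : ℕ → ℝ) (G : ℕ → ℕ → ℂ) {P Q : ℝ}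
    (hdiag : ∀ m ∈ Ioc 0 X, ‖∑ k ∈ s, G k m * conj (G k m)‖ ≤ P)
    (hoff : ∀ m ∈ Ioc 0 X, ∀ m' ∈ Ioc 0 X, m ≠ m' → ‖∑ k ∈ s, G k m * conj (G k m')‖ ≤ Q)
    (hQ : 0 ≤ Q) :
    ∑ k ∈ s, ‖∑ m ∈ Ioc 0 X, (b m : ℂ) * G k m‖ ^ 2 ≤
      Q * (∑ m ∈ Ioc 0 X, |b m|) ^ 2 + P * ∑ m ∈ Ioc 0 X, b m ^ 2 := by
  have h1 : ((∑ k ∈ s, ‖∑ m ∈ Ioc 0 X, (b m : ℂ) * G k m‖ ^ 2 : ℝ) : ℂ) =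
      ∑ m ∈ Ioc 0 X, ∑ m' ∈ Ioc 0 X, (b m : ℂ) * b m' * ∑ k ∈ s, G k m * conj (G k m') := by
    push_cast
    calc ∑ k ∈ s, (‖∑ m ∈ Ioc 0 X, (b m : ℂ) * G k m‖ : ℂ) ^ 2
        = ∑ k ∈ s, ∑ m ∈ Ioc 0 X, ∑ m' ∈ Ioc 0 X,
            (b m : ℂ) * b m' * (G k m * conj (G k m')) := by
          refine sum_congr rfl fun k _ => ?_
          rw [← Complex.mul_conj', map_sum, sum_mul_sum]
          refine sum_congr rfl fun m _ => sum_congr rfl fun m' _ => ?_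
          rw [map_mul, Complex.conj_ofReal]
          ring
      _ = _ := by
          rw [sum_comm]
          refine sum_congr rfl fun m _ => ?_
          rw [sum_comm]
          refine sum_congr rfl fun m' _ => ?_
          rw [mul_sum]
  have h2 : ∑ k ∈ s, ‖∑ m ∈ Ioc 0 X, (b m : ℂ) * G k m‖ ^ 2 =
      ‖((∑ k ∈ s, ‖∑ m ∈ Ioc 0 X, (b m : ℂ) * G k m‖ ^ 2 : ℝ) : ℂ)‖ := by
    rw [Complex.norm_real, Real.norm_of_nonneg (sum_nonneg fun _ _ => sq_nonneg _)]
  rw [h2, h1]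
  calc ‖∑ m ∈ Ioc 0 X, ∑ m' ∈ Ioc 0 X, (b m : ℂ) * b m' * ∑ k ∈ s, G k m * conj (G k m')‖
      ≤ ∑ m ∈ Ioc 0 X, ∑ m' ∈ Ioc 0 X, (|b m| * |b m'| * Q + if m = m' then P * b m ^ 2 else 0) := by
        refine (norm_sum_le _ _).trans (sum_le_sum fun m hm => ?_)
        refine (norm_sum_le _ _).trans (sum_le_sum fun m' hm' => ?_)
        rw [norm_mul, norm_mul, Complex.norm_real, Complex.norm_real, Real.norm_eq_abs,
          Real.norm_eq_abs]
        split_ifs with h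
        · subst h
          have h3 := mul_le_mul_of_nonneg_left (hdiag m hm) (sq_nonneg (b m))
          rw [← sq_abs] at h3 ⊢
          have : 0 ≤ |b m| * |b m| * Q := by positivity
          nlinarith
        · rw [add_zero]
          exact mul_le_mul_of_nonneg_left (hoff m hm m' hm' h) (by positivity)
    _ = _ := by
        simp_rw [sum_add_distrib]
        congr 1
        · rw [sq, sum_mul_sum, mul_sum]
          refine sum_congr rfl fun m _ => ?_
          rw [mul_sum]
          exact sum_congr rfl fun m' _ => by ring
        · rw [mul_sum]
          refine sum_congr rfl fun m hm => ?_
          rw [sum_ite_eq, if_pos hm]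

theorem norm_bilinear_block_le (F : ℕ → ℂ) (hF : ∀ n, ‖F n‖ ≤ 1) (N u M : ℕ) (hu : 1 ≤ u) {E : ℝ}
    (hE : 0 ≤ E)
    (hII : ∀ M b m m' : ℕ, u ≤ M → b ≤ 2 * M → b ≤ N → 1 ≤ m → m ≤ N → 1 ≤ m' → m' ≤ N → m ≠ m' →
      ‖∑ k ∈ Ioc M b, F (k * m) * conj (F (k * m'))‖ ≤ E * M)
    (hM : u ≤ M) (a b : ℕ → ℝ) (ha : ∀ k, |a k| ≤ Real.log k) (hb0 : ∀ m ≤ u, b m = 0)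
    (hb : ∀ m, |b m| ≤ m.divisors.card) :
    ‖∑ k ∈ Ioc M (min (2 * M) N), (a k : ℂ) * ∑ m ∈ Ioc 0 (N / k), (b m : ℂ) * F (k * m)‖ ≤
      N * (1 + Real.log N) ^ 2 * Real.sqrt (E + 2 / Real.sqrt u) := by
  rcases Nat.eq_zero_or_pos N with rfl | hN
  · simp
  set X := N / (M + 1) with hX
  set L := Real.log N with hL
  have hL0 : 0 ≤ L := Real.log_natCast_nonneg N
  have hNk : ∀ k, M < k → N / k ≤ X := fun k hk => Nat.div_le_div_left hk (Nat.succ_pos M)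
  rcases le_or_gt X u with hXu | hXu
  · rw [sum_eq_zero, norm_zero]
    · positivity
    intro k hk
    rw [sum_eq_zero, mul_zero]
    intro m hm
    rw [hb0 m ((mem_Ioc.1 hm).2.trans ((hNk k (mem_Ioc.1 hk).1).trans hXu))]
    simp
  set G : ℕ → ℕ → ℂ := fun k m => if k * m ≤ N then F (k * m) else 0 with hG
  have hinner : ∀ k ∈ Ioc M (min (2 * M) N), ∑ m ∈ Ioc 0 (N / k), (b m : ℂ) * F (k * m) =
      ∑ m ∈ Ioc 0 X, (b m : ℂ) * G k m := by
    intro k hk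
    have hk' := mem_Ioc.1 hk
    rw [← sum_subset (Ioc_subset_Ioc_right (hNk k hk'.1))]
    · refine sum_congr rfl fun m hm => ?_
      have h := (Nat.le_div_iff_mul_le (by lia)).1 (mem_Ioc.1 hm).2
      simp only [hG]
      rw [if_pos (by rwa [mul_comm])]
    · intro m hm hm'
      have h : ¬ k * m ≤ N := by
        intro h
        refine hm' (mem_Ioc.2 ⟨(mem_Ioc.1 hm).1, (Nat.le_div_iff_mul_le (by lia)).2 ?_⟩)
        rwa [mul_comm]
      simp only [hG]
      rw [if_neg h, mul_zero]
  rw [sum_congr rfl fun k hk => by rw [hinner k hk]]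
  have hXN : X ≤ N := Nat.div_le_self _ _
  have hMX : (M : ℝ) * X ≤ N := by
    have : M * X ≤ N := by
      calc M * X ≤ (M + 1) * X := by gcongr; simp
        _ ≤ N := Nat.mul_div_le N (M + 1)
    exact_mod_cast this
  have hX1 : (1 : ℝ) ≤ X := by exact_mod_cast (by lia : 1 ≤ X)
  have hlogX : Real.log X ≤ L := Real.log_le_log (by linarith) (by exact_mod_cast hXN)
  have hcorr : ∀ m ∈ Ioc 0 X, ∀ m' ∈ Ioc 0 X,
      ∑ k ∈ Ioc M (min (2 * M) N), G k m * conj (G k m') =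
        ∑ k ∈ Ioc M (min (min (2 * M) N) (min (N / m) (N / m'))), F (k * m) * conj (F (k * m')) := by
    intro m hm m' hm'
    have hm0 := (mem_Ioc.1 hm).1
    have hm0' := (mem_Ioc.1 hm').1
    rw [← sum_subset (Ioc_subset_Ioc_right (min_le_left _ (min (N / m) (N / m'))))]
    · refine sum_congr rfl fun k hk => ?_
      have h1 := (mem_Ioc.1 hk).2
      rw [le_min_iff, le_min_iff (b := N / m'), Nat.le_div_iff_mul_le hm0, Nat.le_div_iff_mul_le hm0'] at h1
      simp only [hG]
      rw [if_pos h1.2.1, if_pos h1.2.2]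
    · intro k hk hk'
      simp only [hG]
      split_ifs with h1 h2
      · refine absurd (mem_Ioc.2 ⟨(mem_Ioc.1 hk).1, ?_⟩) hk'
        rw [le_min_iff, le_min_iff (b := N / m'), Nat.le_div_iff_mul_le hm0, Nat.le_div_iff_mul_le hm0']
        exact ⟨(mem_Ioc.1 hk).2, h1, h2⟩
      all_goals simp
  have hsq := sum_normSq_le (Ioc M (min (2 * M) N)) X b G (P := M) (Q := E * M)
    (fun m hm => by
      rw [hcorr m hm m hm]
      refine (norm_sum_le_of_le (n := fun _ => (1 : ℝ)) _ fun k _ => ?_).trans ?_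
      · rw [norm_mul, RCLike.norm_conj]
        nlinarith [hF (k * m), norm_nonneg (F (k * m))]
      · rw [sum_const, nsmul_one, Nat.card_Ioc]
        exact_mod_cast (by lia))
    (fun m hm m' hm' hne => by
      rw [hcorr m hm m' hm']
      have h1 := mem_Ioc.1 hm
      have h2 := mem_Ioc.1 hm'
      refine hII _ _ _ _ hM ((min_le_left _ _).trans (min_le_left _ _))
        ((min_le_left _ _).trans (min_le_right _ _)) ?_ ?_ ?_ ?_ hne <;> lia)
    (by positivity)
  have hb1 : ∑ m ∈ Ioc 0 X, |b m| ≤ X * (1 + L) :=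
    (sum_le_sum fun m _ => hb m).trans ((sum_card_divisors_le X).trans (by gcongr))
  have hb2 : ∑ m ∈ Ioc 0 X, b m ^ 2 ≤ 2 * Real.sqrt X * (X * (1 + L)) := by
    refine (sum_le_sum fun m hm => ?_).trans
      ((mul_sum _ _ _).symm.le.trans (mul_le_mul_of_nonneg_left
        ((sum_card_divisors_le X).trans (by gcongr)) (by positivity)))
    have h1 : (m.divisors.card : ℝ) ≤ 2 * Real.sqrt X := (card_divisors_le_two_sqrt m).trans (by
      have : (m : ℝ) ≤ X := by exact_mod_cast (mem_Ioc.1 hm).2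
      gcongr)
    rw [← sq_abs, sq]
    exact mul_le_mul ((hb m).trans h1) (hb m) (abs_nonneg _) (by positivity)
  have ha2 : ∑ k ∈ Ioc M (min (2 * M) N), a k ^ 2 ≤ M * L ^ 2 := by
    refine (sum_le_card_nsmul _ _ (L ^ 2) fun k hk => ?_).trans ?_
    · have hk' := mem_Ioc.1 hk
      rw [← sq_abs]
      refine pow_le_pow_left₀ (abs_nonneg _) ((ha k).trans (Real.log_le_log ?_ ?_)) 2
      · exact_mod_cast (by lia : 0 < k)
      · exact_mod_cast hk'.2.trans (min_le_right _ _)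
    · rw [nsmul_eq_mul, Nat.card_Ioc]
      have : ((min (2 * M) N - M : ℕ) : ℝ) ≤ M := by exact_mod_cast (by lia)
      gcongr
  have hu0 : (0 : ℝ) < u := by exact_mod_cast hu
  have hsu : 0 < Real.sqrt u := Real.sqrt_pos.2 hu0
  have hsX : Real.sqrt u ≤ Real.sqrt X := Real.sqrt_le_sqrt (by exact_mod_cast hXu.le)
  have hfin : ‖∑ k ∈ Ioc M (min (2 * M) N), (a k : ℂ) * ∑ m ∈ Ioc 0 X, (b m : ℂ) * G k m‖ ^ 2 ≤
      (N * (1 + L) ^ 2) ^ 2 * (E + 2 / Real.sqrt u) := by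
    calc _ ≤ (M * L ^ 2) * (E * M * (X * (1 + L)) ^ 2 + M * (2 * Real.sqrt X * (X * (1 + L)))) := by
          refine (normSq_sum_mul_le _ _ _).trans (mul_le_mul ha2 (hsq.trans ?_) ?_ ?_)
          · have h0 : 0 ≤ ∑ m ∈ Ioc 0 X, |b m| := sum_nonneg fun _ _ => abs_nonneg _
            gcongr
          · exact sum_nonneg fun _ _ => sq_nonneg _
          · positivity
      _ = L ^ 2 * (1 + L) * ((1 + L) * E * (M * X) ^ 2 + (M * X) ^ 2 * 2 * (Real.sqrt X / X)) := by
          field_simp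
      _ = L ^ 2 * (1 + L) * ((1 + L) * E * (M * X) ^ 2 + (M * X) ^ 2 * 2 * (1 / Real.sqrt X)) := by
          rw [Real.sqrt_div_self, one_div]
      _ ≤ (1 + L) ^ 2 * (1 + L) * ((1 + L) * E * N ^ 2 + N ^ 2 * 2 * ((1 + L) / Real.sqrt u)) := by
          gcongr <;> linarith
      _ = _ := by ring
  calc _ = Real.sqrt (‖∑ k ∈ Ioc M (min (2 * M) N),
        (a k : ℂ) * ∑ m ∈ Ioc 0 X, (b m : ℂ) * G k m‖ ^ 2) := (Real.sqrt_sq (norm_nonneg _)).symm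
    _ ≤ Real.sqrt ((N * (1 + L) ^ 2) ^ 2 * (E + 2 / Real.sqrt u)) := Real.sqrt_le_sqrt hfin
    _ = _ := by
        rw [Real.sqrt_mul (sq_nonneg _), Real.sqrt_sq (by positivity)]

/-- Vaughan's method: bounds for sums of types I and II bound the sum over primes. -/
theorem norm_sum_vonMangoldt_le (F : ℕ → ℂ) (hF : ∀ n, ‖F n‖ ≤ 1) (N u : ℕ) (hu : 1 ≤ u)
    {E : ℝ} (hE : 0 ≤ E)
    (hI : ∀ k j : ℕ, 1 ≤ k → k ≤ u * u → k * j ≤ N → ‖∑ m ∈ Ioc 0 j, F (k * m)‖ ≤ E * (N / k : ℝ))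
    (hII : ∀ M b m m' : ℕ, u ≤ M → b ≤ 2 * M → b ≤ N → 1 ≤ m → m ≤ N → 1 ≤ m' → m' ≤ N → m ≠ m' →
      ‖∑ k ∈ Ioc M b, F (k * m) * conj (F (k * m'))‖ ≤ E * M) :
    ‖∑ n ∈ Ioc 0 N, (vonMangoldt n : ℂ) * F n‖ ≤
      u * Real.log N + 3 * (E * N * (1 + Real.log N) ^ 2) +
        (Nat.log 2 N + 1 : ℕ) * (N * (1 + Real.log N) ^ 2 * Real.sqrt (E + 2 / Real.sqrt u)) := by
  set L := Real.log N with hL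
  have hL0 : 0 ≤ L := Real.log_natCast_nonneg N
  set f₁ := (μ : ArithmeticFunction ℝ).below u with hf₁
  set Λ₁ := vonMangoldt.below u with hΛ₁
  have hlog : ∀ k ∈ Ioc 0 N, Real.log k ≤ L := fun k hk => by
    have hk' := mem_Ioc.1 hk
    exact Real.log_le_log (by exact_mod_cast hk'.1) (by exact_mod_cast hk'.2)
  have hsplit : ∑ n ∈ Ioc 0 N, (vonMangoldt n : ℂ) * F n =
      ∑ n ∈ Ioc 0 N, (Λ₁ n : ℂ) * F n +
      ∑ n ∈ Ioc 0 N, ((f₁ * log) n : ℂ) * F n -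
      ∑ n ∈ Ioc 0 N, (((f₁ * Λ₁) * (ζ : ArithmeticFunction ℝ)) n : ℂ) * F n +
      ∑ n ∈ Ioc 0 N, (((vonMangoldt - Λ₁) * (((μ : ArithmeticFunction ℝ) - f₁) *
        (ζ : ArithmeticFunction ℝ))) n : ℂ) * F n := by
    rw [← sum_add_distrib, ← sum_sub_distrib, ← sum_add_distrib]
    refine sum_congr rfl fun n _ => ?_
    have h := congrArg (fun g : ArithmeticFunction ℝ => g n) (vonMangoldt_eq_vaughan u)
    have h' : vonMangoldt n = Λ₁ n + (f₁ * log) n - ((f₁ * Λ₁) * (ζ : ArithmeticFunction ℝ)) n +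
        ((vonMangoldt - Λ₁) * (((μ : ArithmeticFunction ℝ) - f₁) *
          (ζ : ArithmeticFunction ℝ))) n := by
      simp only [sub_eq_add_neg, ArithmeticFunction.add_apply, ArithmeticFunction.neg_apply] at h ⊢
      exact h
    rw [h']
    push_cast
    ring
  have hT1 : ‖∑ n ∈ Ioc 0 N, (Λ₁ n : ℂ) * F n‖ ≤ u * L := by
    rcases Nat.eq_zero_or_pos N with rfl | hN
    · simp [hL]
    refine (norm_sum_le_of_le (n := fun n => if n ≤ u then L else 0) _ fun n hn => ?_).trans ?_
    · rw [norm_mul, Complex.norm_real, Real.norm_eq_abs, hΛ₁, ArithmeticFunction.below_apply]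
      split_ifs
      · rw [abs_of_nonneg vonMangoldt_nonneg]
        nlinarith [hF n, norm_nonneg (F n), hlog n hn, vonMangoldt_le_log (n := n),
          vonMangoldt_nonneg (n := n)]
      · simp
    · rw [← sum_filter, sum_const, nsmul_eq_mul]
      have h : #{n ∈ Ioc 0 N | n ≤ u} ≤ u := by
        refine (card_le_card (t := Ioc 0 u) fun n hn => ?_).trans (by simp)
        simp only [mem_filter, mem_Ioc] at hn ⊢
        exact ⟨hn.1.1, hn.2⟩
      gcongr
  have hdivN : ∀ k, 0 < k → k * (N / k) ≤ N := fun k _ => Nat.mul_div_le N k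
  have hT2 : ‖∑ n ∈ Ioc 0 N, ((f₁ * log) n : ℂ) * F n‖ ≤ 2 * (E * N * (1 + L) ^ 2) := by
    rw [sum_Ioc_mul_arithmeticFunction]
    refine (norm_sum_le_of_le (n := fun k : ℕ => (2 * L * E * N) / (k : ℝ)) _ fun k hk => ?_).trans
      ((sum_div_le_mul_log N (2 * L * E * N) (by positivity)).trans ?_)
    · have hk' := mem_Ioc.1 hk
      rw [norm_mul, Complex.norm_real, Real.norm_eq_abs, hf₁, ArithmeticFunction.below_apply]
      split_ifs with hku
      · have h1 := abs_moebius_le_one' k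
        have h2 := norm_sum_monotone_mul_le (fun m => Real.log m)
          (fun a b hab => by
            rcases Nat.eq_zero_or_pos a with rfl | ha
            · simpa using Real.log_natCast_nonneg b
            · exact Real.log_le_log (by exact_mod_cast ha) (by exact_mod_cast hab))
          (by simp) (fun m => F (k * m)) (N / k) (B := E * (N / k : ℝ)) (fun i hi => hI k i hk'.1
            (hku.trans (Nat.le_mul_of_pos_left u hu)) ((Nat.mul_le_mul_left k hi).trans
              (Nat.mul_div_le N k)))
        have h3 : Real.log ((N / k : ℕ) : ℝ) ≤ L := by
          rcases Nat.eq_zero_or_pos (N / k) with h0 | h0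
          · rw [h0]; simpa using hL0
          · exact hlog _ (mem_Ioc.2 ⟨h0, Nat.div_le_self _ _⟩)
        have h4 : 0 ≤ E * (N / k : ℝ) := by positivity
        have h5 : 2 * Real.log ((N / k : ℕ) : ℝ) * (E * (N / k : ℝ)) ≤ 2 * L * E * N / k := by
          rw [show 2 * L * E * N / k = 2 * L * (E * (N / k : ℝ)) by ring]
          gcongr
        simp only [log_apply]
        refine (mul_le_mul h1 (h2.trans h5) (norm_nonneg _) zero_le_one).trans ?_
        rw [one_mul]
      · rw [abs_zero, zero_mul]
        positivity
    · have : 2 * L * E * N * (1 + L) ≤ 2 * (1 + L) * E * N * (1 + L) := by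
        gcongr
        linarith
      linarith
  have hT3 : ‖∑ n ∈ Ioc 0 N, (((f₁ * Λ₁) * (ζ : ArithmeticFunction ℝ)) n : ℂ) * F n‖ ≤
      E * N * (1 + L) ^ 2 := by
    rw [sum_Ioc_mul_arithmeticFunction]
    refine (norm_sum_le_of_le (n := fun k : ℕ => (L * E * N) / (k : ℝ)) _ fun k hk => ?_).trans
      ((sum_div_le_mul_log N (L * E * N) (by positivity)).trans ?_)
    · have hk' := mem_Ioc.1 hk
      rw [norm_mul, Complex.norm_real, Real.norm_eq_abs]
      rcases le_or_gt k (u * u) with hku | hku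
      · have h1 := (abs_moebius_below_mul_vonMangoldt_below_le u k).trans (hlog k hk)
        have h2 : ∑ m ∈ Ioc 0 (N / k), (((ζ : ArithmeticFunction ℝ) m : ℝ) : ℂ) * F (k * m) =
            ∑ m ∈ Ioc 0 (N / k), F (k * m) := by
          refine sum_congr rfl fun m hm => ?_
          have hm' : m ≠ 0 := (mem_Ioc.1 hm).1.ne'
          rw [natCoe_apply, zeta_apply_ne hm']
          simp
        rw [h2, show L * E * N / k = L * (E * (N / k : ℝ)) by ring]
        exact mul_le_mul h1 (hI k _ hk'.1 hku (Nat.mul_div_le N k)) (norm_nonneg _) hL0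
      · rw [moebius_below_mul_vonMangoldt_below_eq_zero hku, abs_zero, zero_mul]
        positivity
    · have : L * E * N * (1 + L) ≤ (1 + L) * E * N * (1 + L) := by
        gcongr
        linarith
      linarith
  have hT4 : ‖∑ n ∈ Ioc 0 N, (((vonMangoldt - Λ₁) * (((μ : ArithmeticFunction ℝ) - f₁) *
        (ζ : ArithmeticFunction ℝ))) n : ℂ) * F n‖ ≤
      (Nat.log 2 N + 1 : ℕ) * (N * (1 + L) ^ 2 * Real.sqrt (E + 2 / Real.sqrt u)) := by
    rw [sum_Ioc_mul_arithmeticFunction]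
    set G : ℕ → ℂ := fun k => ((vonMangoldt - Λ₁) k : ℂ) * ∑ m ∈ Ioc 0 (N / k),
      ((((μ : ArithmeticFunction ℝ) - f₁) * (ζ : ArithmeticFunction ℝ)) m : ℂ) * F (k * m) with hG
    have h0 : ∑ k ∈ Ioc 0 N, G k = ∑ k ∈ Ioc u N, G k := by
      symm
      refine sum_subset (Ioc_subset_Ioc_left (Nat.zero_le u)) fun k hk hk' => ?_
      have hku : k ≤ u := by
        by_contra h
        exact hk' (mem_Ioc.2 ⟨by lia, (mem_Ioc.1 hk).2⟩)
      simp only [hG]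
      rw [ArithmeticFunction.sub_below_apply, if_pos hku]
      simp
    rw [h0]
    refine norm_sum_Ioc_le_of_dyadic G (by positivity) N _ u (fun M hM _ => ?_) ?_
    · refine norm_bilinear_block_le F hF N u M hu hE hII hM (fun k => (vonMangoldt - Λ₁) k)
        (fun m => (((μ : ArithmeticFunction ℝ) - f₁) * (ζ : ArithmeticFunction ℝ)) m)
        (fun k => ?_) (fun m hm => tail_mul_zeta_eq_zero hm) (fun m => abs_tail_mul_zeta_le u m)
      rw [ArithmeticFunction.sub_below_apply]
      split_ifs
      · simpa using Real.log_natCast_nonneg k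
      · rw [abs_of_nonneg vonMangoldt_nonneg]
        exact vonMangoldt_le_log
    · exact (Nat.lt_pow_succ_log_self one_lt_two N).le.trans (Nat.le_mul_of_pos_right _ hu)
  rw [hsplit]
  refine (norm_add_le _ _).trans ?_
  refine (add_le_add ((norm_sub_le _ _).trans (add_le_add (norm_add_le _ _) le_rfl))
    le_rfl).trans ?_
  linarith

end Bilinear

section PrimeSums

open Finset ArithmeticFunction
open scoped ComplexConjugate

theorem exists_dyadic_bound {ι : Type*} [Fintype ι] (α θ : ι → ℝ) (i₀ : ι)
    (hα : 0 < α i₀) (hθ : IsTopIndex θ i₀) {A : ℝ} (hA : 0 ≤ A) :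
    ∃ C δ N₀ : ℝ, 0 < C ∧ 0 < δ ∧ δ ≤ 1 / 16 ∧ 1 ≤ N₀ ∧ ∀ N : ℕ, N₀ ≤ N → ∀ (M b : ℕ) (w : ι → ℝ),
      (N : ℝ) ^ (1 / 8 : ℝ) ≤ M → b ≤ 2 * M → IsDominated θ i₀ w →
      (N : ℝ) ^ (-(1 / 16) : ℝ) ≤ |w i₀| → |w i₀| ≤ (N : ℝ) ^ A →
      ‖∑ k ∈ Ioc M b, addChar (∑ i, α i * w i * (k : ℝ) ^ θ i)‖ ≤ C * (N : ℝ) ^ (-δ) * M := by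
  obtain ⟨C, δ, M₀, hC, hδ, hδ1, hM₀, h⟩ := exists_block_bound α θ i₀ hα hθ (8 * A + θ i₀)
  refine ⟨C, δ / 16, M₀ ^ (8 : ℝ), hC, by linarith, by linarith,
    Real.one_le_rpow hM₀ (by norm_num), fun N hN M b w hM hb hw h1 h2 => ?_⟩
  have hN1 : (1 : ℝ) ≤ N := (Real.one_le_rpow hM₀ (by norm_num)).trans hN
  have hN0 : (0 : ℝ) < N := by linarith
  have hM0M : M₀ ≤ M := by
    refine le_trans ?_ hM
    rw [← Real.rpow_le_rpow_iff (by linarith) (by positivity) (show (0 : ℝ) < 8 by norm_num),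
      ← Real.rpow_mul hN0.le]
    norm_num at hN ⊢
    exact hN
  have hM1 : (1 : ℝ) ≤ M := hM₀.trans hM0M
  have hMp : (0 : ℝ) < M := by linarith
  have hNM : (N : ℝ) ≤ (M : ℝ) ^ (8 : ℝ) := by
    have := Real.rpow_le_rpow (by positivity) hM (show (0 : ℝ) ≤ 8 by norm_num)
    rwa [← Real.rpow_mul hN0.le, show (1 / 8 : ℝ) * 8 = 1 by norm_num, Real.rpow_one] at this
  have hθ1 := hθ.one_le i₀
  have hlow : (M : ℝ) ^ (1 / 2 : ℝ) ≤ |w i₀| * (M : ℝ) ^ θ i₀ := by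
    have h3 : (M : ℝ) ^ (-(1 / 2) : ℝ) ≤ |w i₀| := by
      refine le_trans ?_ h1
      have := Real.rpow_le_rpow_of_nonpos hN0 hNM (show (-(1 / 16) : ℝ) ≤ 0 by norm_num)
      rwa [← Real.rpow_mul hMp.le, show (8 : ℝ) * -(1 / 16) = -(1 / 2) by norm_num] at this
    calc (M : ℝ) ^ (1 / 2 : ℝ) = (M : ℝ) ^ (-(1 / 2) : ℝ) * (M : ℝ) ^ (1 : ℝ) := by
          rw [← Real.rpow_add hMp]; norm_num
      _ ≤ _ := by
          refine mul_le_mul h3 (Real.rpow_le_rpow_of_exponent_le hM1 hθ1) (by positivity)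
            (abs_nonneg _)
  have hhigh : |w i₀| * (M : ℝ) ^ θ i₀ ≤ (M : ℝ) ^ (8 * A + θ i₀) := by
    rw [Real.rpow_add hMp, Real.rpow_mul hMp.le]
    refine mul_le_mul_of_nonneg_right (h2.trans ?_) (by positivity)
    exact Real.rpow_le_rpow hN0.le hNM hA
  have h4 := h M hM0M w hw hlow hhigh (M + 1) (b - M) (by lia) (by lia)
  have h5 : ∑ k ∈ Ioc M b, addChar (∑ i, α i * w i * (k : ℝ) ^ θ i) =
      ∑ x ∈ range (b - M), addChar (∑ i, α i * w i * ((M + 1 + x : ℕ) : ℝ) ^ θ i) := by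
    rw [show Ioc M b = Ico (M + 1) (b + 1) by ext; simp, sum_Ico_eq_sum_range]
    congr 2
    lia
  rw [h5]
  refine h4.trans ?_
  rw [sub_eq_add_neg, Real.rpow_add hMp, Real.rpow_one]
  have h6 : (M : ℝ) ^ (-δ) ≤ (N : ℝ) ^ (-(δ / 16)) := by
    calc (M : ℝ) ^ (-δ) ≤ ((N : ℝ) ^ (1 / 8 : ℝ)) ^ (-δ) :=
          Real.rpow_le_rpow_of_nonpos (by positivity) hM (by linarith)
      _ = (N : ℝ) ^ (-(δ / 8)) := by
          rw [← Real.rpow_mul hN0.le]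
          congr 1
          ring
      _ ≤ _ := Real.rpow_le_rpow_of_exponent_le hN1 (by linarith)
  calc C * (M * (M : ℝ) ^ (-δ)) ≤ C * (M * (N : ℝ) ^ (-(δ / 16))) := by gcongr
    _ = _ := by ring

theorem rpow_sub_rpow_le_of_le {x y a b : ℝ} (hy : 1 ≤ y) (hxy : y ≤ x) (ha : 0 ≤ a) (hab : a ≤ b) :
    x ^ a - y ^ a ≤ x ^ b - y ^ b := by
  have hy0 : 0 < y := by linarith
  have h1 : ∀ c : ℝ, x ^ c - y ^ c = y ^ c * ((x / y) ^ c - 1) := fun c => by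
    rw [Real.div_rpow (by linarith) hy0.le]
    field_simp
  have h2 : 1 ≤ x / y := (one_le_div hy0).2 hxy
  rw [h1, h1]
  refine mul_le_mul (Real.rpow_le_rpow_of_exponent_le hy hab)
    (sub_le_sub_right (Real.rpow_le_rpow_of_exponent_le h2 hab) _)
    (sub_nonneg.2 (Real.one_le_rpow h2 ha)) (by positivity)

theorem abs_rpow_sub_rpow_le_of_le {x y a b : ℝ} (hx : 1 ≤ x) (hy : 1 ≤ y) (ha : 0 ≤ a)
    (hab : a ≤ b) : |x ^ a - y ^ a| ≤ |x ^ b - y ^ b| := by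
  wlog hxy : y ≤ x generalizing x y
  · rw [abs_sub_comm, abs_sub_comm (x ^ b)]
    exact this hy hx (le_of_not_ge hxy)
  rw [abs_of_nonneg (sub_nonneg.2 (Real.rpow_le_rpow (by linarith) hxy ha)),
    abs_of_nonneg (sub_nonneg.2 (Real.rpow_le_rpow (by linarith) hxy (ha.trans hab)))]
  exact rpow_sub_rpow_le_of_le hy hxy ha hab

theorem IsTopIndex.isDominated {ι : Type*} {θ : ι → ℝ} {i₀ : ι} (hθ : IsTopIndex θ i₀) {w : ι → ℝ}
    (h : ∀ i, θ i ≤ θ i₀ → |w i| ≤ |w i₀|) : IsDominated θ i₀ w := by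
  intro i
  rcases eq_or_ne i i₀ with rfl | hi
  · exact Or.inr le_rfl
  · exact (hθ.lt_of_ne i hi).imp_right fun hlt => h i hlt.le

theorem exists_log_le_rpow {ε : ℝ} (hε : 0 < ε) :
    ∃ K : ℝ, 1 ≤ K ∧ ∀ N : ℕ, 1 ≤ N → 1 + Real.log N ≤ K * (N : ℝ) ^ ε ∧
      ((Nat.log 2 N + 1 : ℕ) : ℝ) ≤ 2 * (1 + Real.log N) := by
  refine ⟨1 + 1 / ε, by linarith [one_div_pos.2 hε], fun N hN => ⟨?_, ?_⟩⟩
  · have hN1 : (1 : ℝ) ≤ N := by exact_mod_cast hN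
    have h1 := Real.log_le_rpow_div (show (0 : ℝ) ≤ N by linarith) hε
    have h2 := Real.one_le_rpow hN1 hε.le
    rw [add_mul, one_mul, one_div_mul_eq_div]
    linarith
  · have h1 : (Nat.log 2 N : ℝ) ≤ Real.logb 2 N := Real.natLog_le_logb N 2
    rw [Real.logb, le_div_iff₀ (Real.log_pos one_lt_two)] at h1
    have h2 : (1 / 2 : ℝ) < Real.log 2 := by linarith [Real.log_two_gt_d9]
    push_cast
    nlinarith [Nat.cast_nonneg (α := ℝ) (Nat.log 2 N)]

theorem exists_norm_sum_vonMangoldt_addChar_le {ι : Type*} [Fintype ι] (α θ : ι → ℝ) (i₀ : ι)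
    (hα : 0 < α i₀) (hθ : IsTopIndex θ i₀) :
    ∃ C δ N₀ : ℝ, 0 < C ∧ 0 < δ ∧ δ ≤ 1 / 16 ∧ 1 ≤ N₀ ∧ ∀ N : ℕ, N₀ ≤ N → ∀ β : ℝ,
      (N : ℝ) ^ (-(1 / 16) : ℝ) ≤ |β| → |β| ≤ N →
      ‖∑ n ∈ Ioc 0 N, (vonMangoldt n : ℂ) * addChar (β * ∑ i, α i * (n : ℝ) ^ θ i)‖ ≤
        C * (N : ℝ) ^ (1 - δ) := by
  have hθ1 := hθ.one_le i₀
  obtain ⟨C, δ, N₁, hC, hδ, hδ1, hN₁, hblock⟩ :=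
    exists_dyadic_bound α θ i₀ hα hθ (A := 1 + θ i₀) (by linarith)
  obtain ⟨K, hK1, hK⟩ := exists_log_le_rpow (show 0 < δ / 16 by linarith)
  set C₂ : ℝ := 2 * C * K + 8 with hC₂
  have hC₂0 : 0 < C₂ := by positivity
  refine ⟨2 * K + 3 * (C₂ * K ^ 2) + 2 * K ^ 3 * Real.sqrt (C₂ + 2), δ / 4, max N₁ (2 ^ 8),
    by positivity, by linarith, by linarith, hN₁.trans (le_max_left _ _), fun N hN β hβ hβN => ?_⟩
  have hNN₁ : N₁ ≤ N := (le_max_left _ _).trans hN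
  have hN1 : (1 : ℝ) ≤ N := hN₁.trans hNN₁
  have hN0 : (0 : ℝ) < N := by linarith
  have hN1' : 1 ≤ N := by exact_mod_cast hN1
  obtain ⟨hlog, hlog2⟩ := hK N hN1'
  set ℓ := 1 + Real.log N with hℓ
  have hℓ1 : 1 ≤ ℓ := by linarith [Real.log_natCast_nonneg N]
  set u := ⌈(N : ℝ) ^ (1 / 8 : ℝ)⌉₊ with hu
  have hu8 : (1 : ℝ) ≤ (N : ℝ) ^ (1 / 8 : ℝ) := Real.one_le_rpow hN1 (by norm_num)
  have hule : (N : ℝ) ^ (1 / 8 : ℝ) ≤ u := Nat.le_ceil _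
  have hule2 : (u : ℝ) ≤ 2 * (N : ℝ) ^ (1 / 8 : ℝ) := by
    linarith [Nat.ceil_lt_add_one (show 0 ≤ (N : ℝ) ^ (1 / 8 : ℝ) by positivity)]
  have hu1 : 1 ≤ u := by exact_mod_cast hu8.trans hule
  have hpow8 : ((N : ℝ) ^ (1 / 8 : ℝ)) ^ 8 = N := by
    rw [← Real.rpow_natCast, ← Real.rpow_mul hN0.le]
    norm_num
  set t := (N : ℝ) ^ (1 / 8 : ℝ) with ht
  have ht2 : 2 ≤ t := by
    have h : (2 : ℝ) ^ 8 ≤ t ^ 8 := by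
      rw [hpow8]
      exact (le_max_right _ _).trans hN
    exact le_of_pow_le_pow_left₀ (by norm_num) (by positivity) h
  have huuN : u * u ≤ N := by
    have h : (u : ℝ) * u ≤ N := by
      calc (u : ℝ) * u ≤ (2 * t) * (2 * t) := by gcongr
        _ ≤ (t * t) * (t * t) := by gcongr
        _ = t ^ 4 := by ring
        _ ≤ t ^ 8 := pow_le_pow_right₀ (by linarith) (by norm_num)
        _ = N := hpow8
    exact_mod_cast h
  set E : ℝ := 2 * C * ℓ * (N : ℝ) ^ (-δ) + 8 * (N : ℝ) ^ (-(5 / 8) : ℝ) with hE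
  have hE0 : 0 ≤ E := by positivity
  have hEle : E ≤ C₂ * (N : ℝ) ^ (-(15 * δ / 16)) := by
    have h1 : ℓ * (N : ℝ) ^ (-δ) ≤ K * (N : ℝ) ^ (-(15 * δ / 16)) := by
      calc ℓ * (N : ℝ) ^ (-δ) ≤ K * (N : ℝ) ^ (δ / 16) * (N : ℝ) ^ (-δ) := by gcongr
        _ = _ := by
          rw [mul_assoc, ← Real.rpow_add hN0]
          ring_nf
    have h2 : (N : ℝ) ^ (-(5 / 8) : ℝ) ≤ (N : ℝ) ^ (-(15 * δ / 16)) :=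
      Real.rpow_le_rpow_of_exponent_le hN1 (by linarith)
    calc E = 2 * C * (ℓ * (N : ℝ) ^ (-δ)) + 8 * (N : ℝ) ^ (-(5 / 8) : ℝ) := by rw [hE]; ring
      _ ≤ 2 * C * (K * (N : ℝ) ^ (-(15 * δ / 16))) + 8 * (N : ℝ) ^ (-(15 * δ / 16)) := by gcongr
      _ = _ := by rw [hC₂]; ring
  have hphase : ∀ k m : ℕ, β * ∑ i, α i * ((k * m : ℕ) : ℝ) ^ θ i =
      ∑ i, α i * (β * (k : ℝ) ^ θ i) * (m : ℝ) ^ θ i := fun k m => by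
    rw [mul_sum]
    refine sum_congr rfl fun i _ => ?_
    rw [Nat.cast_mul, Real.mul_rpow (Nat.cast_nonneg k) (Nat.cast_nonneg m)]
    ring
  have hNA : (N : ℝ) ^ (1 + θ i₀) = N * (N : ℝ) ^ θ i₀ := by
    rw [Real.rpow_add hN0, Real.rpow_one]
  have hmain := norm_sum_vonMangoldt_le (fun n => addChar (β * ∑ i, α i * (n : ℝ) ^ θ i))
    (fun n => (norm_addChar _).le) N u hu1 hE0
    (fun k j hk hku hkj => by
      have hk1 : (1 : ℝ) ≤ k := by exact_mod_cast hk
      have hk0 : (0 : ℝ) < k := by linarith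
      have hkN : (k : ℝ) ≤ N := by exact_mod_cast hku.trans huuN
      have hjk : (j : ℝ) ≤ N / k := by
        rw [le_div_iff₀ hk0]
        exact_mod_cast (by rwa [mul_comm])
      have hukN : (u : ℝ) ≤ 8 * (N : ℝ) ^ (-(5 / 8) : ℝ) * (N / k : ℝ) := by
        rw [← mul_div_assoc, le_div_iff₀ hk0]
        have h1 : (k : ℝ) ≤ u * u := by exact_mod_cast hku
        calc (u : ℝ) * k ≤ (2 * t) * ((2 * t) * (2 * t)) := by
              refine mul_le_mul hule2 (h1.trans ?_) hk0.le (by positivity)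
              gcongr
          _ = 8 * t ^ 3 := by ring
          _ = _ := by
            rw [mul_assoc, ← Real.rpow_add_one hN0.ne', ht, ← Real.rpow_natCast,
              ← Real.rpow_mul hN0.le]
            norm_num
      have hsum : ∀ a b, ∑ m ∈ Ioc a b, addChar (β * ∑ i, α i * ((k * m : ℕ) : ℝ) ^ θ i) =
          ∑ m ∈ Ioc a b, addChar (∑ i, α i * (β * (k : ℝ) ^ θ i) * (m : ℝ) ^ θ i) := fun a b =>
        sum_congr rfl fun m _ => by rw [hphase]
      have hlong : ‖∑ m ∈ Ioc u j, addChar (β * ∑ i, α i * ((k * m : ℕ) : ℝ) ^ θ i)‖ ≤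
          (Nat.log 2 N + 1 : ℕ) * (C * (N : ℝ) ^ (-δ) * (N / k : ℝ)) := by
        refine norm_sum_Ioc_le_of_dyadic _ (by positivity) j _ u (fun M hM hMj => ?_) ?_
        · rw [hsum]
          refine (hblock N hNN₁ M _ (fun i => β * (k : ℝ) ^ θ i) ?_ (min_le_left _ _) ?_ ?_
            ?_).trans ?_
          · exact hule.trans (by exact_mod_cast hM)
          · refine hθ.isDominated fun i hi => ?_
            rw [abs_mul, abs_mul, abs_of_pos (Real.rpow_pos_of_pos hk0 _),
              abs_of_pos (Real.rpow_pos_of_pos hk0 _)]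
            exact mul_le_mul_of_nonneg_left (Real.rpow_le_rpow_of_exponent_le hk1 hi)
              (abs_nonneg _)
          · rw [abs_mul, abs_of_pos (Real.rpow_pos_of_pos hk0 _)]
            exact hβ.trans (le_mul_of_one_le_right (abs_nonneg _)
              (Real.one_le_rpow hk1 (by linarith)))
          · rw [abs_mul, abs_of_pos (Real.rpow_pos_of_pos hk0 _), hNA]
            exact mul_le_mul hβN (Real.rpow_le_rpow hk0.le hkN (by linarith)) (by positivity)
              hN0.le
          · have h : (M : ℝ) ≤ N / k := le_trans (by exact_mod_cast hMj.le) hjk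
            gcongr
        · have h1 : j ≤ N := (Nat.le_mul_of_pos_left j hk).trans hkj
          exact (h1.trans (Nat.lt_pow_succ_log_self one_lt_two N).le).trans
            (Nat.le_mul_of_pos_right _ hu1)
      have hshort : ∀ a : ℕ, ‖∑ m ∈ Ioc 0 a, addChar (β * ∑ i, α i * ((k * m : ℕ) : ℝ) ^ θ i)‖ ≤
          a := fun a => by
        refine (norm_sum_le_of_le (n := fun _ => (1 : ℝ)) _ fun m _ => (norm_addChar _).le).trans ?_
        simp
      have hEexp : E * (N / k : ℝ) = 8 * (N : ℝ) ^ (-(5 / 8) : ℝ) * (N / k : ℝ) +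
          2 * ℓ * (C * (N : ℝ) ^ (-δ) * (N / k : ℝ)) := by rw [hE]; ring
      have hpos : 0 ≤ C * (N : ℝ) ^ (-δ) * (N / k : ℝ) := by positivity
      have hlong2 := hlong.trans (mul_le_mul_of_nonneg_right hlog2 hpos)
      rw [hEexp]
      rcases le_total j u with hju | hju
      · refine (hshort j).trans ?_
        have h1 : (j : ℝ) ≤ u := by exact_mod_cast hju
        have h2 : 0 ≤ 2 * ℓ * (C * (N : ℝ) ^ (-δ) * (N / k : ℝ)) := by positivity
        linarith
      · rw [← sum_Ioc_consecutive _ (Nat.zero_le u) hju]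
        refine (norm_add_le _ _).trans (add_le_add ((hshort u).trans hukN) hlong2))
    (fun M b m m' hM hb hbN hm hmN hm' hmN' hne => by
      have hm1 : (1 : ℝ) ≤ m := by exact_mod_cast hm
      have hm1' : (1 : ℝ) ≤ m' := by exact_mod_cast hm'
      have hmNr : (m : ℝ) ≤ N := by exact_mod_cast hmN
      have hmNr' : (m' : ℝ) ≤ N := by exact_mod_cast hmN'
      have hsum : ∑ k ∈ Ioc M b, addChar (β * ∑ i, α i * ((k * m : ℕ) : ℝ) ^ θ i) *
          conj (addChar (β * ∑ i, α i * ((k * m' : ℕ) : ℝ) ^ θ i)) =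
          ∑ k ∈ Ioc M b, addChar (∑ i, α i * (β * ((m : ℝ) ^ θ i - (m' : ℝ) ^ θ i)) *
            (k : ℝ) ^ θ i) := by
        refine sum_congr rfl fun k _ => ?_
        rw [← addChar_sub, mul_comm k m, mul_comm k m', hphase, hphase, ← sum_sub_distrib]
        congr 1
        exact sum_congr rfl fun i _ => by ring
      rw [hsum]
      refine (hblock N hNN₁ M b (fun i => β * ((m : ℝ) ^ θ i - (m' : ℝ) ^ θ i)) ?_ hb ?_ ?_
        ?_).trans ?_
      · exact hule.trans (by exact_mod_cast hM)
      · refine hθ.isDominated fun i hi => ?_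
        rw [abs_mul, abs_mul]
        exact mul_le_mul_of_nonneg_left (abs_rpow_sub_rpow_le_of_le hm1 hm1'
          (by linarith [hθ.one_le i]) hi) (abs_nonneg _)
      · rw [abs_mul]
        have h1 := abs_rpow_sub_rpow_le_of_le hm1 hm1' zero_le_one hθ1
        have h2 : (1 : ℝ) ≤ |(m : ℝ) - m'| := by
          have h3 : (1 : ℤ) ≤ |(m : ℤ) - m'| := Int.one_le_abs (by lia)
          exact_mod_cast h3
        rw [Real.rpow_one, Real.rpow_one] at h1
        exact hβ.trans (le_mul_of_one_le_right (abs_nonneg _) (h2.trans h1))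
      · rw [abs_mul, hNA]
        refine mul_le_mul hβN ?_ (abs_nonneg _) hN0.le
        have h1 : (m : ℝ) ^ θ i₀ ≤ (N : ℝ) ^ θ i₀ :=
          Real.rpow_le_rpow (by linarith) hmNr (by linarith)
        have h2 : (m' : ℝ) ^ θ i₀ ≤ (N : ℝ) ^ θ i₀ :=
          Real.rpow_le_rpow (by linarith) hmNr' (by linarith)
        have h3 : 0 ≤ (m : ℝ) ^ θ i₀ := by positivity
        have h4 : 0 ≤ (m' : ℝ) ^ θ i₀ := by positivity
        rw [abs_le]
        constructor <;> linarith
      · have h1 : C * (N : ℝ) ^ (-δ) ≤ E := by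
          have h2 : C * (N : ℝ) ^ (-δ) * 1 ≤ C * (N : ℝ) ^ (-δ) * (2 * ℓ) := by
            gcongr
            linarith
          have h3 : 0 ≤ 8 * (N : ℝ) ^ (-(5 / 8) : ℝ) := by positivity
          rw [hE]
          linarith
        gcongr)
  refine hmain.trans ?_
  have hlogN : Real.log N ≤ ℓ := by linarith
  have hNp : ∀ a : ℝ, a ≤ 1 - δ / 4 → (N : ℝ) ^ a ≤ (N : ℝ) ^ (1 - δ / 4) := fun a ha =>
    Real.rpow_le_rpow_of_exponent_le hN1 ha
  have hA1 : (u : ℝ) * Real.log N ≤ 2 * K * (N : ℝ) ^ (1 - δ / 4) := by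
    calc (u : ℝ) * Real.log N ≤ (2 * t) * (K * (N : ℝ) ^ (δ / 16)) :=
          mul_le_mul hule2 (hlogN.trans hlog) (Real.log_natCast_nonneg N) (by positivity)
      _ = 2 * K * (N : ℝ) ^ (1 / 8 + δ / 16) := by
          rw [Real.rpow_add hN0]
          ring
      _ ≤ _ := by
          gcongr 2 * K * ?_
          exact hNp _ (by linarith)
  have hA2 : 3 * (E * N * ℓ ^ 2) ≤ 3 * (C₂ * K ^ 2) * (N : ℝ) ^ (1 - δ / 4) := by
    calc 3 * (E * N * ℓ ^ 2) ≤ 3 * (C₂ * (N : ℝ) ^ (-(15 * δ / 16)) * N *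
          (K * (N : ℝ) ^ (δ / 16)) ^ 2) := by gcongr
      _ = 3 * (C₂ * K ^ 2) * ((N : ℝ) ^ (-(15 * δ / 16)) * (N : ℝ) ^ (1 : ℝ) *
          ((N : ℝ) ^ (δ / 16) * (N : ℝ) ^ (δ / 16))) := by
          rw [Real.rpow_one]
          ring
      _ = 3 * (C₂ * K ^ 2) * (N : ℝ) ^ (-(15 * δ / 16) + 1 + (δ / 16 + δ / 16)) := by
          rw [Real.rpow_add hN0, Real.rpow_add hN0, Real.rpow_add hN0]
      _ ≤ _ := by
          gcongr 3 * (C₂ * K ^ 2) * ?_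
          exact hNp _ (by linarith)
  have hsqrt : Real.sqrt (E + 2 / Real.sqrt u) ≤
      Real.sqrt (C₂ + 2) * (N : ℝ) ^ (-(15 * δ / 32)) := by
    have h1 : 2 / Real.sqrt u ≤ 2 * (N : ℝ) ^ (-(15 * δ / 16)) := by
      rw [div_eq_mul_inv]
      refine mul_le_mul_of_nonneg_left ?_ (by norm_num)
      rw [Real.sqrt_eq_rpow, ← Real.rpow_neg (Nat.cast_nonneg u)]
      calc (u : ℝ) ^ (-(1 / 2) : ℝ) ≤ t ^ (-(1 / 2) : ℝ) :=
            Real.rpow_le_rpow_of_nonpos (by positivity) hule (by norm_num)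
        _ = (N : ℝ) ^ (-(1 / 16) : ℝ) := by
            rw [ht, ← Real.rpow_mul hN0.le]
            norm_num
        _ ≤ _ := Real.rpow_le_rpow_of_exponent_le hN1 (by linarith)
    calc Real.sqrt (E + 2 / Real.sqrt u) ≤ Real.sqrt ((C₂ + 2) * (N : ℝ) ^ (-(15 * δ / 16))) :=
          Real.sqrt_le_sqrt (by linarith)
      _ = _ := by
          rw [Real.sqrt_mul (by positivity), Real.sqrt_eq_rpow ((N : ℝ) ^ _),
            ← Real.rpow_mul hN0.le]
          ring_nf
  have hA3 : ((Nat.log 2 N + 1 : ℕ) : ℝ) * (N * ℓ ^ 2 * Real.sqrt (E + 2 / Real.sqrt u)) ≤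
      2 * K ^ 3 * Real.sqrt (C₂ + 2) * (N : ℝ) ^ (1 - δ / 4) := by
    calc _ ≤ (2 * (K * (N : ℝ) ^ (δ / 16))) * (N * (K * (N : ℝ) ^ (δ / 16)) ^ 2 *
          (Real.sqrt (C₂ + 2) * (N : ℝ) ^ (-(15 * δ / 32)))) := by
          have h1 : ((Nat.log 2 N + 1 : ℕ) : ℝ) ≤ 2 * (K * (N : ℝ) ^ (δ / 16)) :=
            hlog2.trans (by linarith)
          gcongr
      _ = 2 * K ^ 3 * Real.sqrt (C₂ + 2) * ((N : ℝ) ^ (δ / 16) * ((N : ℝ) ^ (1 : ℝ) *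
          ((N : ℝ) ^ (δ / 16) * (N : ℝ) ^ (δ / 16))) * (N : ℝ) ^ (-(15 * δ / 32))) := by
          rw [Real.rpow_one]
          ring
      _ = 2 * K ^ 3 * Real.sqrt (C₂ + 2) *
          (N : ℝ) ^ (δ / 16 + (1 + (δ / 16 + δ / 16)) + -(15 * δ / 32)) := by
          rw [Real.rpow_add hN0, Real.rpow_add hN0, Real.rpow_add hN0, Real.rpow_add hN0]
      _ ≤ _ := by
          gcongr 2 * K ^ 3 * Real.sqrt (C₂ + 2) * ?_
          exact hNp _ (by linarith)
  linarith

end PrimeSums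

section PrimeWeights

open Finset ArithmeticFunction

theorem div_four_le_theta {N : ℕ} (hN : 2 ^ 24 ≤ N) :
    (N : ℝ) / 4 ≤ ∑ p ∈ N.primesLE, Real.log p := by
  have hN' : (2 : ℝ) ^ 24 ≤ N := by exact_mod_cast hN
  have hN0 : (0 : ℝ) < N := by linarith [show (0 : ℝ) < 2 ^ 24 by norm_num]
  have hN1 : (1 : ℝ) ≤ N := by linarith [show (1 : ℝ) ≤ 2 ^ 24 by norm_num]
  have h := Chebyshev.theta_ge N
  rw [Chebyshev.theta_eq_sum_primesLE_log] at h
  set t := (N : ℝ) ^ (1 / 4 : ℝ) with ht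
  have ht4 : t ^ 4 = N := by
    rw [ht, ← Real.rpow_natCast, ← Real.rpow_mul hN0.le]
    norm_num
  have ht0 : 0 < t := by positivity
  have ht64 : 64 ≤ t := by
    refine le_of_pow_le_pow_left₀ (n := 4) (by norm_num) ht0.le ?_
    rw [ht4]
    norm_num at hN' ⊢
    exact hN'
  have hlog : Real.log N ≤ 4 * t := by
    have := Real.log_le_rpow_div hN0.le (show (0 : ℝ) < 1 / 4 by norm_num)
    linarith
  have hsqrt : Real.sqrt N = t ^ 2 := by
    rw [← ht4, show t ^ 4 = (t ^ 2) ^ 2 by ring, Real.sqrt_sq (by positivity)]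
  have hlog1 : Real.log (N + 1) ≤ Real.log N + 1 := by
    have h1 : Real.log (N + 1) ≤ Real.log (2 * N) := Real.log_le_log (by linarith) (by linarith)
    rw [Real.log_mul (by norm_num) hN0.ne'] at h1
    linarith [Real.log_two_lt_d9]
  have hlog2 : (1 / 2 : ℝ) ≤ Real.log 2 := by linarith [Real.log_two_gt_d9]
  rw [hsqrt] at h
  have h1 : 2 * t ^ 2 * Real.log N ≤ 8 * t ^ 3 := by nlinarith [sq_nonneg t]
  have h2 : (N : ℝ) * (1 / 2) ≤ N * Real.log 2 := by gcongr
  have h3 : 64 * t ^ 3 ≤ t ^ 4 := by nlinarith [pow_pos ht0 3]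
  have h4 : 64 * t ^ 2 ≤ t ^ 3 := by nlinarith [pow_pos ht0 2]
  nlinarith

theorem exists_norm_sum_primesLE_addChar_le {ι : Type*} [Fintype ι] (α θ : ι → ℝ) (i₀ : ι)
    (hα : 0 < α i₀) (hθ : IsTopIndex θ i₀) :
    ∃ C δ N₀ : ℝ, 0 < C ∧ 0 < δ ∧ δ ≤ 1 / 16 ∧ 1 ≤ N₀ ∧ ∀ N : ℕ, N₀ ≤ N →
      0 < ∑ p ∈ N.primesLE, Real.log p ∧ ∀ β : ℝ,
      (N : ℝ) ^ (-(1 / 16) : ℝ) ≤ |β| → |β| ≤ N →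
      ‖∑ p ∈ N.primesLE, (Real.log p : ℂ) * addChar (β * ∑ i, α i * (p : ℝ) ^ θ i)‖ ≤
        C * (N : ℝ) ^ (-δ) * ∑ p ∈ N.primesLE, Real.log p := by
  obtain ⟨C, δ, N₀, hC, hδ, hδ1, hN₀, h⟩ := exists_norm_sum_vonMangoldt_addChar_le α θ i₀ hα hθ
  refine ⟨4 * (C + 8), δ, max N₀ (2 ^ 24), by positivity, hδ, hδ1, hN₀.trans (le_max_left _ _),
    fun N hN => ?_⟩
  have hNN₀ : N₀ ≤ N := (le_max_left _ _).trans hN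
  have hN1 : (1 : ℝ) ≤ N := hN₀.trans hNN₀
  have hN0 : (0 : ℝ) < N := by linarith
  have hth := div_four_le_theta (N := N) (by exact_mod_cast (le_max_right _ _).trans hN)
  refine ⟨by linarith, fun β hβ hβN => ?_⟩
  have h1 := h N hNN₀ β hβ hβN
  set F : ℕ → ℂ := fun n => addChar (β * ∑ i, α i * (n : ℝ) ^ θ i) with hF
  have hprime : N.primesLE = {n ∈ Ioc 0 N | n.Prime} := by
    ext p
    simp only [Nat.mem_primesLE, mem_filter, mem_Ioc]
    exact ⟨fun hp => ⟨⟨hp.2.pos, hp.1⟩, hp.2⟩, fun hp => ⟨hp.1.2, hp.2⟩⟩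
  have hsplit : ∑ n ∈ Ioc 0 N, (vonMangoldt n : ℂ) * F n =
      ∑ p ∈ N.primesLE, (Real.log p : ℂ) * F p +
        ∑ n ∈ Ioc 0 N with ¬ n.Prime, (vonMangoldt n : ℂ) * F n := by
    rw [← sum_filter_add_sum_filter_not (Ioc 0 N) Nat.Prime, hprime]
    congr 1
    refine sum_congr rfl fun p hp => ?_
    rw [vonMangoldt_apply_prime (mem_filter.1 hp).2]
  have hnp : ‖∑ n ∈ Ioc 0 N with ¬ n.Prime, (vonMangoldt n : ℂ) * F n‖ ≤
      8 * (N : ℝ) ^ (1 - δ) := by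
    have h2 := Chebyshev.psi_sub_theta_le hN1
    rw [Chebyshev.psi_sub_theta_eq_sum_not_prime, Nat.floor_natCast] at h2
    refine (norm_sum_le_of_le (n := fun n => vonMangoldt n) _ fun n _ => ?_).trans (h2.trans ?_)
    · rw [norm_mul, Complex.norm_real, Real.norm_of_nonneg vonMangoldt_nonneg]
      exact (mul_le_mul_of_nonneg_left (norm_addChar _).le vonMangoldt_nonneg).trans (mul_one _).le
    · have h3 := Real.log_le_rpow_div hN0.le (show (0 : ℝ) < 1 / 4 by norm_num)
      calc 2 * Real.sqrt N * Real.log N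
          ≤ 2 * (N : ℝ) ^ (1 / 2 : ℝ) * (4 * (N : ℝ) ^ (1 / 4 : ℝ)) := by
            rw [Real.sqrt_eq_rpow]
            gcongr
            linarith
        _ = 8 * (N : ℝ) ^ (1 / 2 + 1 / 4 : ℝ) := by
            rw [Real.rpow_add hN0]
            ring
        _ ≤ _ := by
            gcongr
            linarith
  rw [hsplit] at h1
  have h4 : ‖∑ p ∈ N.primesLE, (Real.log p : ℂ) * F p‖ ≤ (C + 8) * (N : ℝ) ^ (1 - δ) := by
    have := norm_sub_le (∑ p ∈ N.primesLE, (Real.log p : ℂ) * F p +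
      ∑ n ∈ Ioc 0 N with ¬ n.Prime, (vonMangoldt n : ℂ) * F n)
      (∑ n ∈ Ioc 0 N with ¬ n.Prime, (vonMangoldt n : ℂ) * F n)
    rw [add_sub_cancel_right] at this
    linarith
  refine h4.trans ?_
  rw [sub_eq_add_neg, Real.rpow_add hN0, Real.rpow_one]
  calc (C + 8) * (N * (N : ℝ) ^ (-δ)) = 4 * (C + 8) * (N : ℝ) ^ (-δ) * (N / 4) := by ring
    _ ≤ _ := by gcongr

end PrimeWeights

section Fejer

open Finset
open scoped ComplexConjugate

theorem sum_mul_normSq_sum_addChar {ι : Type*} (s : Finset ι) (z : ι → ℂ) (x : ι → ℝ) (H : ℕ) :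
    ∑ p ∈ s, z p * ((‖∑ h ∈ range H, addChar (h * x p)‖ ^ 2 : ℝ) : ℂ) =
      ∑ a ∈ range H, ∑ b ∈ range H, ∑ p ∈ s, z p * addChar (((a : ℝ) - b) * x p) := by
  rw [sum_congr rfl fun a _ => sum_comm, sum_comm]
  refine sum_congr rfl fun p _ => ?_
  push_cast
  rw [← Complex.mul_conj', map_sum, sum_mul_sum, mul_sum]
  refine sum_congr rfl fun a _ => ?_
  rw [mul_sum]
  refine sum_congr rfl fun b _ => ?_
  rw [sub_mul, addChar_sub]

theorem abs_sum_mul_normSq_sub_le {ι : Type*} (s : Finset ι) (w x : ι → ℝ) (H : ℕ) {B : ℝ}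
    (hB : ∀ a < H, ∀ b < H, a ≠ b → ‖∑ p ∈ s, (w p : ℂ) * addChar (((a : ℝ) - b) * x p)‖ ≤ B)
    (hB0 : 0 ≤ B) :
    |∑ p ∈ s, w p * ‖∑ h ∈ range H, addChar (h * x p)‖ ^ 2 - H * ∑ p ∈ s, w p| ≤ H ^ 2 * B := by
  have h1 : ((∑ p ∈ s, w p * ‖∑ h ∈ range H, addChar (h * x p)‖ ^ 2 - H * ∑ p ∈ s, w p : ℝ) : ℂ) =
      ∑ a ∈ range H, ∑ b ∈ range H, if a = b then 0 else
        ∑ p ∈ s, (w p : ℂ) * addChar (((a : ℝ) - b) * x p) := by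
    have h2 := sum_mul_normSq_sum_addChar s (fun p => (w p : ℂ)) x H
    have h3 : ∑ a ∈ range H, ∑ b ∈ range H, ∑ p ∈ s, (w p : ℂ) * addChar (((a : ℝ) - b) * x p) =
        (∑ a ∈ range H, ∑ b ∈ range H, if a = b then 0 else
          ∑ p ∈ s, (w p : ℂ) * addChar (((a : ℝ) - b) * x p)) + H * ∑ p ∈ s, (w p : ℂ) := by
      have h4 : (H : ℂ) * ∑ p ∈ s, (w p : ℂ) =
          ∑ a ∈ range H, ∑ b ∈ range H, if a = b then ∑ p ∈ s, (w p : ℂ) else 0 := by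
        have h5 : ∀ a ∈ range H, (∑ b ∈ range H, if a = b then ∑ p ∈ s, (w p : ℂ) else 0) =
            ∑ p ∈ s, (w p : ℂ) := fun a ha => by rw [sum_ite_eq, if_pos ha]
        rw [sum_congr rfl h5]
        simp
      rw [h4, ← sum_add_distrib]
      refine sum_congr rfl fun a _ => ?_
      rw [← sum_add_distrib]
      refine sum_congr rfl fun b _ => ?_
      split_ifs with hab
      · subst hab
        simp [addChar_zero]
      · simp
    push_cast at h2 ⊢
    rw [h2, h3]
    ring
  rw [← Real.norm_eq_abs, ← Complex.norm_real, h1]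
  refine (norm_sum_le_of_le (n := fun _ => H * B) _ fun a ha =>
    (norm_sum_le_of_le (n := fun _ => B) _ fun b hb => ?_).trans ?_).trans ?_
  · split_ifs with hab
    · simpa using hB0
    · exact hB a (mem_range.1 ha) b (mem_range.1 hb) hab
  · simp
  · simp
    linarith

theorem normSq_sum_addChar_le_of_lt {x δ : ℝ} (hδ : 0 < δ) (hx : δ < |x - round x|) (H : ℕ) :
    ‖∑ h ∈ range H, addChar (h * x)‖ ^ 2 ≤ 1 / (4 * δ ^ 2) := by
  set y := x - round x with hy
  have hxy : x = y + (round x : ℤ) := by rw [hy]; ring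
  have h1 : ∀ h : ℕ, addChar (h * x) = addChar (h * y) := fun h => by
    rw [addChar_nat_mul, addChar_nat_mul, hxy, addChar_add, addChar_intCast, mul_one]
  have h0 : 0 < |y| := hδ.trans hx
  have h2 := norm_geom_sum_addChar_le (abs_sub_round x) (abs_pos.1 h0) H
  rw [sum_congr rfl fun h _ => h1 h]
  calc ‖∑ h ∈ range H, addChar (h * y)‖ ^ 2 ≤ (1 / (2 * |y|)) ^ 2 := by gcongr
    _ ≤ (1 / (2 * δ)) ^ 2 := by gcongr
    _ = 1 / (4 * δ ^ 2) := by ring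

theorem norm_sum_addChar_shift {ι : Type*} (s : Finset ι) (w x : ι → ℝ) (h c : ℝ) :
    ‖∑ p ∈ s, (w p : ℂ) * addChar (h * (x p - c))‖ = ‖∑ p ∈ s, (w p : ℂ) * addChar (h * x p)‖ := by
  have h1 : ∑ p ∈ s, (w p : ℂ) * addChar (h * (x p - c)) =
      (∑ p ∈ s, (w p : ℂ) * addChar (h * x p)) * conj (addChar (h * c)) := by
    rw [sum_mul]
    refine sum_congr rfl fun p _ => ?_
    rw [mul_sub, addChar_sub, mul_assoc]
  rw [h1, norm_mul, RCLike.norm_conj, norm_addChar, mul_one]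

/-- Small Weyl sums force a point close to any prescribed centre. -/
theorem exists_abs_sub_round_le {ι : Type*} (s : Finset ι) (w x : ι → ℝ) (hw : ∀ p ∈ s, 0 ≤ w p)
    (hW : 0 < ∑ p ∈ s, w p) (c : ℝ) {δ ε : ℝ} (hδ : 0 < δ) (hε : 0 ≤ ε) (H : ℕ)
    (hH : 1 / δ ^ 2 ≤ H) (hHε : H * ε ≤ 1 / 2)
    (h : ∀ a < H, ∀ b < H, a ≠ b →
      ‖∑ p ∈ s, (w p : ℂ) * addChar (((a : ℝ) - b) * x p)‖ ≤ ε * ∑ p ∈ s, w p) :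
    ∃ p ∈ s, |x p - c - round (x p - c)| ≤ δ := by
  by_contra! hcon
  set W := ∑ p ∈ s, w p with hWdef
  have h1 := abs_sum_mul_normSq_sub_le s w (fun p => x p - c) H (B := ε * W)
    (fun a ha b hb hab => by rw [norm_sum_addChar_shift]; exact h a ha b hb hab) (by positivity)
  have h2 : ∑ p ∈ s, w p * ‖∑ h ∈ range H, addChar (h * (x p - c))‖ ^ 2 ≤ W * (1 / (4 * δ ^ 2)) := by
    rw [hWdef, sum_mul]
    exact sum_le_sum fun p hp => mul_le_mul_of_nonneg_left
      (normSq_sum_addChar_le_of_lt hδ (hcon p hp) H) (hw p hp)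
  have h3 := (abs_le.1 h1).1
  rw [← hWdef] at h3
  have h4 : 1 / (4 * δ ^ 2) ≤ (H : ℝ) / 4 := by
    rw [show 1 / (4 * δ ^ 2) = 1 / δ ^ 2 / 4 by field_simp]
    linarith
  have h5 : 0 < (H : ℝ) := (by positivity : 0 < 1 / δ ^ 2).trans_le hH
  have h6 : (H : ℝ) ^ 2 * (ε * W) ≤ H * W * (1 / 2) := by
    calc (H : ℝ) ^ 2 * (ε * W) = H * W * (H * ε) := by ring
      _ ≤ _ := by gcongr
  have h7 : W * (1 / (4 * δ ^ 2)) ≤ W * (H / 4) := by gcongr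
  have h8 : 0 < W * H := by positivity
  linarith

/-- A two-dimensional version of `exists_abs_sub_round_le`. -/
theorem exists_abs_sub_round_le_and_le {ι : Type*} (s : Finset ι) (w x y : ι → ℝ)
    (hw : ∀ p ∈ s, 0 ≤ w p) (hW : 0 < ∑ p ∈ s, w p) (c : ℝ) {δ ε : ℝ} (hδ : 0 < δ) (hε : 0 ≤ ε)
    (H : ℕ) (hH : 2 / δ ^ 2 ≤ H) (hHε : (H : ℝ) ^ 2 * ε ≤ 1 / 8)
    (h : ∀ a < H, ∀ b < H, ∀ a' < H, ∀ b' < H, (a ≠ b ∨ a' ≠ b') →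
      ‖∑ p ∈ s, (w p : ℂ) * addChar (((a : ℝ) - b) * x p + ((a' : ℝ) - b') * y p)‖ ≤
        ε * ∑ p ∈ s, w p) :
    ∃ p ∈ s, |x p - round (x p)| ≤ δ ∧ |y p - c - round (y p - c)| ≤ δ := by
  by_contra! hcon
  set W := ∑ p ∈ s, w p with hWdef
  have hH0 : 0 < (H : ℝ) := (by positivity : 0 < 2 / δ ^ 2).trans_le hH
  have hH1 : (1 : ℝ) ≤ H := by exact_mod_cast hH0
  have hHpos : 0 < H := by exact_mod_cast hH0
  have hHε1 : H * ε ≤ 1 / 8 := by nlinarith [mul_nonneg hH0.le hε]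
  have hx := abs_sum_mul_normSq_sub_le s w x H (B := ε * W)
    (fun a ha b hb hab => by simpa using h a ha b hb 0 hHpos 0 hHpos (Or.inl hab)) (by positivity)
  have hy := abs_sum_mul_normSq_sub_le s w (fun p => y p - c) H (B := ε * W)
    (fun a ha b hb hab => by
      rw [norm_sum_addChar_shift]
      simpa using h 0 hHpos 0 hHpos a ha b hb (Or.inr hab)) (by positivity)
  set V := ∑ p ∈ s, w p * ‖∑ h ∈ range H, addChar (h * x p)‖ ^ 2 with hV
  have hxy := abs_sum_mul_normSq_sub_le s (fun p => w p * ‖∑ h ∈ range H, addChar (h * x p)‖ ^ 2)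
    (fun p => y p - c) H (B := H ^ 2 * (ε * W))
    (fun a ha b hb hab => by
      rw [norm_sum_addChar_shift]
      have h1 := sum_mul_normSq_sum_addChar s
        (fun p => (w p : ℂ) * addChar (((a : ℝ) - b) * y p)) x H
      have h2 : ∑ p ∈ s, ((w p * ‖∑ h ∈ range H, addChar (h * x p)‖ ^ 2 : ℝ) : ℂ) *
          addChar (((a : ℝ) - b) * y p) = ∑ p ∈ s, (w p : ℂ) * addChar (((a : ℝ) - b) * y p) *
            ((‖∑ h ∈ range H, addChar (h * x p)‖ ^ 2 : ℝ) : ℂ) := by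
        refine sum_congr rfl fun p _ => ?_
        push_cast
        ring
      rw [h2, h1]
      refine (norm_sum_le_of_le (n := fun _ => H * (ε * W)) _ fun a' ha' =>
        (norm_sum_le_of_le (n := fun _ => ε * W) _ fun b' hb' => ?_).trans ?_).trans ?_
      · refine le_trans (le_of_eq ?_) (h a' (mem_range.1 ha') b' (mem_range.1 hb') a ha b hb
          (Or.inr hab))
        congr 1
        refine sum_congr rfl fun p _ => ?_
        rw [addChar_add]
        ring
      · simp
      · simp
        linarith) (by positivity)
  rw [← hV] at hxy
  have hpt : ∑ p ∈ s, w p * ‖∑ h ∈ range H, addChar (h * x p)‖ ^ 2 *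
      ‖∑ h ∈ range H, addChar (h * (y p - c))‖ ^ 2 ≤ 1 / (4 * δ ^ 2) *
        (V + ∑ p ∈ s, w p * ‖∑ h ∈ range H, addChar (h * (y p - c))‖ ^ 2) := by
    rw [hV, ← sum_add_distrib, mul_sum]
    refine sum_le_sum fun p hp => ?_
    have h1 := hw p hp
    set X := ‖∑ h ∈ range H, addChar (h * x p)‖ ^ 2 with hX
    set Y := ‖∑ h ∈ range H, addChar (h * (y p - c))‖ ^ 2 with hY
    have hX0 : 0 ≤ X := sq_nonneg _
    have hY0 : 0 ≤ Y := sq_nonneg _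
    have hq : 0 < 1 / (4 * δ ^ 2) := by positivity
    rcases le_or_gt (|x p - round (x p)|) δ with hxp | hxp
    · have h2 : Y ≤ 1 / (4 * δ ^ 2) := normSq_sum_addChar_le_of_lt hδ (hcon p hp hxp) H
      have h3 : w p * X * Y ≤ w p * X * (1 / (4 * δ ^ 2)) := by gcongr
      have h4 : 0 ≤ 1 / (4 * δ ^ 2) * (w p * Y) := by positivity
      linarith
    · have h2 : X ≤ 1 / (4 * δ ^ 2) := normSq_sum_addChar_le_of_lt hδ hxp H
      have h3 : w p * X * Y ≤ w p * (1 / (4 * δ ^ 2)) * Y := by gcongr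
      have h4 : 0 ≤ 1 / (4 * δ ^ 2) * (w p * X) := by positivity
      linarith
  have hq : 1 / (4 * δ ^ 2) ≤ (H : ℝ) / 8 := by
    rw [show 1 / (4 * δ ^ 2) = 2 / δ ^ 2 / 8 by field_simp; norm_num]
    linarith
  have e1 : (H : ℝ) ^ 2 * (ε * W) ≤ H * W * (1 / 8) := by
    calc (H : ℝ) ^ 2 * (ε * W) = H * W * (H * ε) := by ring
      _ ≤ _ := by gcongr
  have e2 : (H : ℝ) ^ 2 * (H ^ 2 * (ε * W)) ≤ H ^ 2 * W * (1 / 8) := by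
    calc (H : ℝ) ^ 2 * (H ^ 2 * (ε * W)) = H ^ 2 * W * (H ^ 2 * ε) := by ring
      _ ≤ _ := by gcongr
  have hVlow : H * W * (7 / 8) ≤ V := by linarith [(abs_le.1 hx).1]
  have hsum : V + ∑ p ∈ s, w p * ‖∑ h ∈ range H, addChar (h * (y p - c))‖ ^ 2 ≤
      H * W * (18 / 8) := by linarith [(abs_le.1 hx).2, (abs_le.1 hy).2]
  have hup := hpt.trans (mul_le_mul hq hsum
    (add_nonneg (sum_nonneg fun p hp => mul_nonneg (hw p hp) (sq_nonneg _))
      (sum_nonneg fun p hp => mul_nonneg (hw p hp) (sq_nonneg _))) (by positivity))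
  have hlow := (abs_le.1 hxy).1
  have e3 : H * (H * W * (7 / 8)) ≤ H * V := by gcongr
  have e4 : 0 < (H : ℝ) ^ 2 * W := by positivity
  nlinarith

end Fejer

section Assembly

open Finset

variable {ι : Type*} [Fintype ι] {α θ : ι → ℝ}

theorem exists_prime_near_of_forall_le {g : ℕ → ℝ} {N H : ℕ} {ε ξ ρ σ : ℝ}
    (hε : 0 ≤ ε) (hW : 0 < ∑ p ∈ N.primesLE, Real.log p)
    (hg : ∀ β : ℝ, σ ≤ |β| → |β| ≤ N → ‖∑ p ∈ N.primesLE, (Real.log p : ℂ) * addChar (β * g p)‖ ≤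
      ε * ∑ p ∈ N.primesLE, Real.log p)
    (hξ0 : 0 ≤ ξ) (hξ1 : ξ < 1) (hρ0 : 0 < ρ) (hρ1 : ρ ≤ 1) (hH : 32 / ρ ^ 2 ≤ H)
    (hHε : (H : ℝ) ^ 2 * ε ≤ 1 / 8) (hHN : 2 * (H : ℝ) ≤ N)
    (h : ∀ a b : ℤ, |a| < H → |b| < H → (a ≠ 0 ∨ b ≠ 0) → σ ≤ |a * ξ + b|) :
    ∃ p : ℕ, p.Prime ∧ p ≤ N ∧ ∃ z : ℤ, |ξ * ⌊g p⌋ - z| ≤ ρ := by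
  obtain ⟨p, hp, hx, hy⟩ := exists_abs_sub_round_le_and_le N.primesLE (fun p => Real.log p)
    (fun p => ξ * g p) (fun p => g p) (fun p _ => Real.log_natCast_nonneg p) hW (ρ / 2)
    (δ := ρ / 4) (by positivity) hε H (by convert hH using 1; field_simp; norm_num) hHε
    (fun a ha b hb a' ha' b' hb' hne => by
      have h1 := h ((a : ℤ) - b) ((a' : ℤ) - b') (by rw [abs_lt]; omega) (by rw [abs_lt]; omega)
        (by omega)
      push_cast at h1
      have ha : (a : ℝ) < H := by exact_mod_cast ha
      have hb : (b : ℝ) < H := by exact_mod_cast hb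
      have ha' : (a' : ℝ) < H := by exact_mod_cast ha'
      have hb' : (b' : ℝ) < H := by exact_mod_cast hb'
      have ha0 : (0 : ℝ) ≤ a := a.cast_nonneg
      have hb0 : (0 : ℝ) ≤ b := b.cast_nonneg
      have ha0' : (0 : ℝ) ≤ a' := a'.cast_nonneg
      have hb0' : (0 : ℝ) ≤ b' := b'.cast_nonneg
      have h2 : |((a : ℝ) - b) * ξ + (a' - b')| ≤ N := by
        have h3 : |((a : ℝ) - b) * ξ| ≤ H := by
          rw [abs_mul, abs_of_nonneg hξ0]
          have : |(a : ℝ) - b| ≤ H := abs_le.2 ⟨by linarith, by linarith⟩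
          nlinarith [abs_nonneg ((a : ℝ) - b)]
        have h4 : |(a' : ℝ) - b'| ≤ H := abs_le.2 ⟨by linarith, by linarith⟩
        linarith [abs_add_le (((a : ℝ) - b) * ξ) (a' - b')]
      refine le_trans (le_of_eq ?_) (hg _ h1 h2)
      congr 1
      refine sum_congr rfl fun p _ => ?_
      congr 2
      ring)
  rw [Nat.mem_primesLE] at hp
  refine ⟨p, hp.2, hp.1, round (ξ * g p), ?_⟩
  set m := round (g p - ρ / 2) with hm
  rw [abs_le] at hy
  have hfloor : ⌊g p⌋ = m := by
    rw [Int.floor_eq_iff]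
    constructor <;> linarith [hy.1, hy.2]
  rw [hfloor]
  have h1 : ξ * m - round (ξ * g p) = (ξ * g p - round (ξ * g p)) - ξ * (g p - m) := by ring
  have h2 : |ξ * (g p - m)| ≤ 3 * ρ / 4 := by
    rw [abs_of_nonneg (mul_nonneg hξ0 (by linarith [hy.1]))]
    nlinarith [hy.1, hy.2]
  rw [h1]
  linarith [abs_sub (ξ * g p - round (ξ * g p)) (ξ * (g p - m))]

theorem exists_prime_dvd_floor {g : ℕ → ℝ} {N q : ℕ} {ε σ : ℝ} (hq : 0 < q) (hε : 0 ≤ ε)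
    (hW : 0 < ∑ p ∈ N.primesLE, Real.log p)
    (hg : ∀ β : ℝ, σ ≤ |β| → |β| ≤ N → ‖∑ p ∈ N.primesLE, (Real.log p : ℂ) * addChar (β * g p)‖ ≤
      ε * ∑ p ∈ N.primesLE, Real.log p)
    (hqε : 16 * (q : ℝ) ^ 2 * ε ≤ 1 / 2) (hqN : 16 * (q : ℝ) ^ 2 ≤ N) (hqσ : σ ≤ 1 / q) :
    ∃ p : ℕ, p.Prime ∧ p ≤ N ∧ (q : ℤ) ∣ ⌊g p⌋ := by
  have hq0 : (0 : ℝ) < q := by exact_mod_cast hq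
  have hq1 : (1 : ℝ) ≤ q := by exact_mod_cast hq
  obtain ⟨p, hp, hx⟩ := exists_abs_sub_round_le N.primesLE (fun p => Real.log p)
    (fun p => g p / q) (fun p _ => Real.log_natCast_nonneg p) hW (1 / (2 * q))
    (δ := 1 / (4 * q)) (by positivity) hε (16 * q ^ 2)
    (by push_cast; field_simp; norm_num) (by push_cast; exact hqε)
    (fun a ha b hb hab => by
      have h1 : (1 : ℝ) ≤ |(a : ℝ) - b| := by
        have : (1 : ℤ) ≤ |(a : ℤ) - b| := Int.one_le_abs (by omega)
        exact_mod_cast this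
      have ha : (a : ℝ) < 16 * q ^ 2 := by exact_mod_cast ha
      have hb : (b : ℝ) < 16 * q ^ 2 := by exact_mod_cast hb
      have h2 : |(a : ℝ) - b| ≤ 16 * q ^ 2 :=
        abs_le.2 ⟨by linarith [a.cast_nonneg (α := ℝ)], by linarith [b.cast_nonneg (α := ℝ)]⟩
      have h3 : |((a : ℝ) - b) / q| = |(a : ℝ) - b| / q := by rw [abs_div, abs_of_pos hq0]
      refine le_trans (le_of_eq ?_) (hg (((a : ℝ) - b) / q) ?_ ?_)
      · congr 1
        refine sum_congr rfl fun p _ => ?_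
        congr 2
        ring
      · rw [h3]
        exact hqσ.trans (by gcongr)
      · rw [h3]
        exact (div_le_self (abs_nonneg _) hq1).trans (h2.trans hqN))
  rw [Nat.mem_primesLE] at hp
  refine ⟨p, hp.2, hp.1, ?_⟩
  set m := round (g p / q - 1 / (2 * q)) with hm
  have hfloor : ⌊g p⌋ = q * m := by
    rw [Int.floor_eq_iff]
    have h1 : g p / q - 1 / (2 * q) - m = (g p - 1 / 2 - q * m) / q := by field_simp
    rw [h1, abs_div, abs_of_pos hq0, div_le_iff₀ hq0, show 1 / (4 * (q : ℝ)) * q = 1 / 4 by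
      field_simp, abs_le] at hx
    push_cast
    constructor <;> linarith [hx.1, hx.2]
  exact ⟨m, hfloor⟩

theorem sum_mul_rpow_le {D : ℝ} (hα : ∀ i, 0 ≤ α i) (hD : ∀ i, θ i ≤ D) {x : ℝ}
    (hx : 1 ≤ x) : ∑ i, α i * x ^ θ i ≤ (∑ i, α i) * x ^ D := by
  rw [sum_mul]
  exact sum_le_sum fun i _ => mul_le_mul_of_nonneg_left
    (Real.rpow_le_rpow_of_exponent_le hx (hD i)) (hα i)

set_option maxHeartbeats 1000000 in
theorem exists_prime_mul_floor_near {i₀ : ι} {D : ℝ} (hα : ∀ i, 0 < α i) (hθ : IsTopIndex θ i₀)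
    (hD : ∀ i, θ i ≤ D) :
    ∃ (η C : ℝ) (N₀ : ℕ), 0 < η ∧ 0 < C ∧ ∀ (ξ : ℝ) (N : ℕ), 0 ≤ ξ → ξ < 1 → N₀ ≤ N →
      ∃ p : ℕ, p.Prime ∧ p ≤ N ∧
        ∃ z : ℤ, |ξ * ⌊∑ i, α i * (p : ℝ) ^ θ i⌋ - z| ≤ C * (N : ℝ) ^ (-η) := by
  obtain ⟨C, δ, N₁, hC, hδ, hδ1, hN₁, key⟩ :=
    exists_norm_sum_primesLE_addChar_le α θ i₀ (hα i₀) hθ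
  have hD1 : 1 ≤ D := (hθ.one_le i₀).trans (hD i₀)
  set A := ∑ i, α i with hA
  have hA0 : 0 ≤ A := sum_nonneg fun i _ => (hα i).le
  set κ := 1 / (32 * D) with hκ
  have hκ0 : 0 < κ := by positivity
  have hκ1 : κ ≤ 1 / 32 := by
    rw [hκ]
    gcongr
    linarith
  have hκD : κ * D = 1 / 32 := by
    rw [hκ]
    field_simp
  set η := κ * δ / 16 with hη
  have hη0 : 0 < η := by positivity
  set M := N₁ + 100 + 34848 * (2 * C + 1) with hM
  obtain ⟨N₀, hN₀⟩ := Filter.eventually_atTop.1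
    (((tendsto_rpow_atTop hη0).comp tendsto_natCast_atTop_atTop).eventually_ge_atTop M)
  refine ⟨η, A + 1, max N₀ 1, hη0, by positivity, fun ξ N hξ0 hξ1 hN => ?_⟩
  have hN1 : (1 : ℝ) ≤ N := by exact_mod_cast (le_max_right _ _).trans hN
  have hNpos : (0 : ℝ) < N := by linarith
  have hMX : M ≤ (N : ℝ) ^ η := hN₀ N ((le_max_left _ _).trans hN)
  set X := (N : ℝ) ^ η with hX
  have hX100 : 100 ≤ X := by linarith
  have hX1 : 1 ≤ X := by linarith
  have hX0 : 0 < X := by linarith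
  have hXN₁ : N₁ + 1 ≤ X := by linarith
  have hXC : 34848 * (2 * C + 1) ≤ X := by linarith
  have hρ : (N : ℝ) ^ (-η) = 1 / X := by rw [Real.rpow_neg hNpos.le, one_div]
  have hpow : ∀ (k : ℕ) {e : ℝ}, k * η ≤ e → X ^ k ≤ (N : ℝ) ^ e := fun k e he => by
    rw [hX, ← Real.rpow_natCast, ← Real.rpow_mul hNpos.le]
    exact Real.rpow_le_rpow_of_exponent_le hN1 (by linarith)
  have hηκ : 16 * η = κ * δ := by rw [hη]; ring
  have hηδ : 16 * η ≤ δ := by rw [hηκ]; nlinarith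
  have hηκ' : 16 * η ≤ κ := by rw [hηκ]; nlinarith
  have hNδ : X ^ 16 ≤ (N : ℝ) ^ δ := hpow 16 (by norm_num; exact hηδ)
  have hNX : X ^ 16 ≤ N := by simpa using hpow 16 (e := 1) (by norm_num; linarith)
  set H := ⌈32 * X ^ 2⌉₊ with hH
  have hHlow : 32 * X ^ 2 ≤ H := Nat.le_ceil _
  have hHup : (H : ℝ) ≤ 33 * X ^ 2 := by
    have := Nat.ceil_lt_add_one (show 0 ≤ 32 * X ^ 2 by positivity)
    nlinarith
  by_cases hcase : ∀ a b : ℤ, |a| < H → |b| < H → (a ≠ 0 ∨ b ≠ 0) →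
      (N : ℝ) ^ (-(1 / 16) : ℝ) ≤ |a * ξ + b|
  · have hNN₁ : N₁ ≤ N := by linarith [le_self_pow₀ hX1 (show 16 ≠ 0 by norm_num)]
    obtain ⟨hW, hg⟩ := key N hNN₁
    obtain ⟨p, hp, hpN, z, hz⟩ := exists_prime_near_of_forall_le (ρ := 1 / X) (by positivity) hW hg
      hξ0 hξ1 (by positivity) (by rw [div_le_one hX0]; exact hX1)
      (by convert hHlow using 1; field_simp) (by
        rw [Real.rpow_neg hNpos.le, ← div_eq_mul_inv, ← mul_div_assoc,
          div_le_iff₀ (by positivity)]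
        have h1 : (H : ℝ) ^ 2 * C ≤ (33 * X ^ 2) ^ 2 * C := by gcongr
        have h2 : 8712 * C ≤ X := by linarith
        have h3 : X ^ 4 * (8712 * C) ≤ X ^ 4 * X := by gcongr
        have h4 : X ^ 5 ≤ X ^ 16 := pow_le_pow_right₀ hX1 (by norm_num)
        nlinarith) (by
        have h3 : X ^ 2 * 66 ≤ X ^ 2 * X := by gcongr; linarith
        have h4 : X ^ 3 ≤ X ^ 16 := pow_le_pow_right₀ hX1 (by norm_num)
        nlinarith) hcase
    refine ⟨p, hp, hpN, z, hz.trans ?_⟩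
    rw [hρ]
    exact le_mul_of_one_le_left (by positivity) (by linarith)
  · push Not at hcase
    obtain ⟨a, b, ha, hb, hab, hlt⟩ := hcase
    have hσ1 : (N : ℝ) ^ (-(1 / 16) : ℝ) ≤ 1 :=
      Real.rpow_le_one_of_one_le_of_nonpos hN1 (by norm_num)
    have ha0 : a ≠ 0 := by
      rintro rfl
      have hb0 : b ≠ 0 := by simpa using hab
      have h1 : (1 : ℝ) ≤ |(b : ℝ)| := by exact_mod_cast Int.one_le_abs hb0
      simp only [Int.cast_zero, zero_mul, zero_add] at hlt
      linarith
    set q := a.natAbs with hq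
    have hq0 : 0 < q := Int.natAbs_pos.2 ha0
    have hqpos : (0 : ℝ) < q := by exact_mod_cast hq0
    have hqH : (q : ℝ) ≤ H := by
      have : (q : ℤ) < H := by rwa [hq, Int.natCast_natAbs]
      have : q ≤ H := by omega
      exact_mod_cast this
    have hqX : (q : ℝ) ≤ 33 * X ^ 2 := hqH.trans hHup
    set L := ⌊(N : ℝ) ^ κ⌋₊ with hL
    have hXκ : X ≤ (N : ℝ) ^ κ := by simpa using hpow 1 (e := κ) (by norm_num; linarith)
    have hLlow : (N : ℝ) ^ κ / 2 ≤ L := by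
      have := Nat.lt_floor_add_one ((N : ℝ) ^ κ)
      linarith
    have hLup : (L : ℝ) ≤ (N : ℝ) ^ κ := Nat.floor_le (by positivity)
    have hLN₁ : N₁ ≤ L := by
      have := Nat.lt_floor_add_one ((N : ℝ) ^ κ)
      linarith
    have hL1 : (1 : ℝ) ≤ L := hN₁.trans hLN₁
    have hLpos : (0 : ℝ) < L := by linarith
    have hLδ : X ^ 16 / 2 ≤ (L : ℝ) ^ δ := by
      calc X ^ 16 / 2 ≤ (N : ℝ) ^ (κ * δ) / 2 := by
            gcongr
            exact hpow 16 (by norm_num; linarith)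
        _ = ((N : ℝ) ^ κ) ^ δ / 2 := by rw [Real.rpow_mul hNpos.le]
        _ ≤ ((N : ℝ) ^ κ) ^ δ / 2 ^ δ := by
            gcongr
            exact Real.rpow_le_self_of_one_le (by norm_num) (by linarith)
        _ = ((N : ℝ) ^ κ / 2) ^ δ := by rw [Real.div_rpow (by positivity) (by norm_num)]
        _ ≤ (L : ℝ) ^ δ := by gcongr
    have hmain : 16 * (q : ℝ) ^ 2 * (2 * C + 1) ≤ (L : ℝ) ^ δ := by
      have h1 : 16 * (q : ℝ) ^ 2 * (2 * C + 1) ≤ 16 * (33 * X ^ 2) ^ 2 * (2 * C + 1) := by gcongr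
      have h3 : X ^ 4 * (34848 * (2 * C + 1)) ≤ X ^ 4 * X := by gcongr
      have h4 : X ^ 5 ≤ X ^ 16 := pow_le_pow_right₀ hX1 (by norm_num)
      nlinarith
    have hq1 : (1 : ℝ) ≤ q := by exact_mod_cast hq0
    have hqq : 16 * (q : ℝ) ^ 2 ≤ (L : ℝ) ^ δ :=
      (le_mul_of_one_le_right (by positivity) (by linarith)).trans hmain
    have hLδ0 : 0 < (L : ℝ) ^ δ := by positivity
    obtain ⟨hW, hg⟩ := key L hLN₁
    obtain ⟨p, hp, hpL, k, hk⟩ := exists_prime_dvd_floor (q := q) hq0 (by positivity) hW hg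
      (by
        rw [Real.rpow_neg hLpos.le, ← div_eq_mul_inv, ← mul_div_assoc, div_le_iff₀ hLδ0]
        nlinarith [sq_nonneg (q : ℝ)])
      (hqq.trans (by
        simpa using Real.rpow_le_rpow_of_exponent_le hL1 (show δ ≤ 1 by linarith)))
      (by
        rw [Real.rpow_neg hLpos.le, ← one_div]
        refine one_div_le_one_div_of_le hqpos ?_
        have : (L : ℝ) ^ δ ≤ (L : ℝ) ^ (1 / 16 : ℝ) :=
          Real.rpow_le_rpow_of_exponent_le hL1 hδ1
        nlinarith)
    have hLN : L ≤ N := by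
      have : (L : ℝ) ≤ N := hLup.trans (by
        simpa using Real.rpow_le_rpow_of_exponent_le hN1 (show κ ≤ 1 by linarith))
      exact_mod_cast this
    obtain ⟨m, hm⟩ : a ∣ ⌊∑ i, α i * (p : ℝ) ^ θ i⌋ := Int.natAbs_dvd.1 ⟨k, hk⟩
    refine ⟨p, hp, hpL.trans hLN, -(m * b), ?_⟩
    have hp1 : (1 : ℝ) ≤ p := by exact_mod_cast hp.one_lt.le
    have hpL' : (p : ℝ) ≤ L := by exact_mod_cast hpL
    have hF0 : 0 ≤ ∑ i, α i * (p : ℝ) ^ θ i :=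
      sum_nonneg fun i _ => mul_nonneg (hα i).le (by positivity)
    have hF : ∑ i, α i * (p : ℝ) ^ θ i ≤ A * (N : ℝ) ^ (1 / 32 : ℝ) := by
      refine (sum_mul_rpow_le (fun i => (hα i).le) hD hp1).trans ?_
      rw [← hκD, Real.rpow_mul hNpos.le]
      gcongr
      exact hpL'.trans hLup
    have hm1 : |(m : ℝ)| ≤ A * (N : ℝ) ^ (1 / 32 : ℝ) := by
      have h1 : |(m : ℝ)| ≤ |(a : ℝ) * m| := by
        rw [abs_mul]
        exact le_mul_of_one_le_left (abs_nonneg _) (by exact_mod_cast Int.one_le_abs ha0)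
      have h2 : (a : ℝ) * m = (⌊∑ i, α i * (p : ℝ) ^ θ i⌋ : ℝ) := by rw [hm]; push_cast; rfl
      have h3 : (0 : ℝ) ≤ (⌊∑ i, α i * (p : ℝ) ^ θ i⌋ : ℝ) :=
        Int.cast_nonneg (Int.floor_nonneg.2 hF0)
      rw [h2, abs_of_nonneg h3] at h1
      exact h1.trans ((Int.floor_le _).trans hF)
    have h1 : ξ * (⌊∑ i, α i * (p : ℝ) ^ θ i⌋ : ℝ) - ((-(m * b) : ℤ) : ℝ) =
        m * (a * ξ + b) := by
      rw [hm]
      push_cast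
      ring
    rw [h1, abs_mul]
    calc |(m : ℝ)| * |a * ξ + b| ≤ A * (N : ℝ) ^ (1 / 32 : ℝ) * (N : ℝ) ^ (-(1 / 16) : ℝ) := by
          gcongr
      _ = A * (N : ℝ) ^ (-(1 / 32) : ℝ) := by
          rw [mul_assoc, ← Real.rpow_add hNpos]
          norm_num
      _ ≤ (A + 1) * (N : ℝ) ^ (-η) := by
          gcongr
          · linarith
          · linarith

theorem exists_isTopIndex {d : ℕ} {θ : Fin (d + 1) → ℝ} (h0 : 1 ≤ θ 0) (hmono : StrictMono θ)
    (hne : ∃ i, ∀ m : ℤ, θ i ≠ m) : ∃ i₀, IsTopIndex θ i₀ := by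
  classical
  have h1 : ∀ i, 1 ≤ θ i := fun i => h0.trans (hmono.monotone (Fin.zero_le i))
  set S := (univ : Finset (Fin (d + 1))).filter fun i => ∀ m : ℤ, θ i ≠ m with hS
  have hSne : S.Nonempty := by
    obtain ⟨i, hi⟩ := hne
    exact ⟨i, by simpa [hS] using hi⟩
  refine ⟨S.max' hSne, fun m hm => ?_, h1, fun i hi => ?_⟩
  · have h2 := S.max'_mem hSne
    exact (mem_filter.1 h2).2 m (by simpa using hm)
  · rcases lt_or_gt_of_ne hi with hlt | hgt
    · exact Or.inr (hmono hlt)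
    · left
      have h2 : i ∉ S := fun hiS => (S.le_max' i hiS).not_gt hgt
      simp only [hS, mem_filter, mem_univ, true_and, not_forall, not_not] at h2
      obtain ⟨m, hm⟩ := h2
      have hm0 : 0 ≤ m := by
        have : (0 : ℝ) ≤ m := by linarith [h1 i]
        exact_mod_cast this
      exact ⟨m.toNat, by rw [hm]; exact_mod_cast (Int.toNat_of_nonneg hm0).symm⟩

end Assembly

theorem nearestIntDist_le_abs_sub_intCast (x : ℝ) (z : ℤ) : nearestIntDist x ≤ |x - z| :=
  round_le x z

/-- For every pseudo-polynomial `f` there exist `η > 0`, `C > 0`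
and `N₀` such that for all real `ξ` and `N ≥ N₀`,
`min_{p ≤ N, p prime} ‖ξ⌊f(p)⌋‖ ≤ C·N^{-η}`. -/
theorem stmt_4 (f : ℝ → ℝ) (hf : IsPseudoPoly f) :
    ∃ (η C : ℝ) (N₀ : ℕ), 0 < η ∧ 0 < C ∧
      ∀ (ξ : ℝ) (N : ℕ), N₀ ≤ N →
        ∃ p : ℕ, p.Prime ∧ p ≤ N ∧
          nearestIntDist (ξ * (⌊f (p : ℝ)⌋ : ℝ)) ≤ C * (N : ℝ) ^ (-η) := by
  obtain ⟨d, α, θ, hα, h0, hmono, hne, hf⟩ := hf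
  obtain ⟨i₀, hi₀⟩ := exists_isTopIndex h0 hmono hne
  obtain ⟨η, C, N₀, hη, hC, h⟩ := exists_prime_mul_floor_near (D := θ (Fin.last d)) hα hi₀
    fun i => hmono.monotone (Fin.le_last i)
  refine ⟨η, C, N₀, hη, hC, fun ξ N hN => ?_⟩
  obtain ⟨p, hp, hpN, z, hz⟩ := h (Int.fract ξ) N (Int.fract_nonneg ξ) (Int.fract_lt_one ξ) hN
  refine ⟨p, hp, hpN, ?_⟩
  rw [hf]
  set n := ⌊∑ i, α i * (p : ℝ) ^ θ i⌋
  refine (nearestIntDist_le_abs_sub_intCast _ (z + ⌊ξ⌋ * n)).trans (le_of_eq_of_le ?_ hz)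
  congr 1
  push_cast
  rw [Int.fract]
  ring
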